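/- arXiv:1409.5424 — 2 statements merged into one kernel-verified Lean document; each statement's English description precedes it below -/
import Mathlib

section
/- The Motzkin polynomial m(x,y) = x⁴y² + x²y⁴ − 3x²y² + 1 satisfies m(a,b) ≥ 0 for all (a,b) ∈ ℝ², but m is not a sum of squares of polynomials in ℝ[x,y]. In particular, there exists a polynomial that is nonnegative on all of ℝ² yet is not SOS. -/
open MvPolynomial

/-- A polynomial is a sum of squares if it is a finite sum of squares of polynomials. -/
def IsSOS {σ : Type*} (p : MvPolynomial σ ℝ) : Prop :=
  ∃ (m : ℕ) (f : Fin m → MvPolynomial σ ℝ), p = ∑ i, f i ^ 2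

/-- The Motzkin polynomial `m(x,y) = x⁴y² + x²y⁴ − 3x²y² + 1`. -/
noncomputable def motzkin : MvPolynomial (Fin 2) ℝ :=
  X 0 ^ 4 * X 1 ^ 2 + X 0 ^ 2 * X 1 ^ 4 - 3 * (X 0 ^ 2 * X 1 ^ 2) + 1

/-- Leading terms of squares cannot cancel in a sum of squares of real polynomials. -/
lemma Polynomial.two_mul_natDegree_le_of_sum_sq_eq {ι : Type*} [Fintype ι]
    {P : ι → Polynomial ℝ} {Q : Polynomial ℝ} (h : ∑ i, P i ^ 2 = Q) (i : ι) :
    2 * (P i).natDegree ≤ Q.natDegree := by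
  by_contra! hlt
  have hP : P i ≠ 0 := by
    rintro h0
    simp [h0] at hlt
  have hdeg : Q.degree < (P i ^ 2).degree :=
    Polynomial.degree_lt_degree (by rwa [Polynomial.natDegree_pow])
  have hlim := Polynomial.div_tendsto_atTop_zero_of_degree_lt Q (P i ^ 2) hdeg
  obtain ⟨x, hx, hroot⟩ := ((hlim.eventually_lt_const one_pos).and
    (Polynomial.eventually_atTop_not_isRoot (P i) hP)).exists
  have hpos : 0 < Polynomial.eval x (P i) ^ 2 := by
    have : Polynomial.eval x (P i) ≠ 0 := hroot
    positivity
  rw [Polynomial.eval_pow, div_lt_one hpos, ← h, Polynomial.eval_finsetSum] at hx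
  refine absurd (Finset.single_le_sum (f := fun j ↦ Polynomial.eval x (P j ^ 2)) (fun j _ ↦ ?_)
    (Finset.mem_univ i)) (not_le.2 (by simpa using hx))
  simpa using sq_nonneg _

/-- The constant coefficient is unchanged by substituting polynomials without constant term. -/
lemma MvPolynomial.coeff_zero_aeval {R σ : Type*} [CommSemiring R] {g : σ → Polynomial R}
    (hg : ∀ i, (g i).coeff 0 = 0) (p : MvPolynomial σ R) :
    (aeval g p).coeff 0 = constantCoeff p := by
  induction p using MvPolynomial.induction_on with
  | C a => simp
  | add p q hp hq => simp [hp, hq]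
  | mul_X p i hp => simp [Polynomial.mul_coeff_zero, hg]

/-- The linear coefficient along the diagonal is the sum of those along the two axes. -/
lemma MvPolynomial.coeff_one_aeval_diagonal {R : Type*} [CommSemiring R]
    (p : MvPolynomial (Fin 2) R) :
    (aeval ![(Polynomial.X : Polynomial R), Polynomial.X] p).coeff 1 =
      (aeval ![(Polynomial.X : Polynomial R), 0] p).coeff 1 +
        (aeval ![0, (Polynomial.X : Polynomial R)] p).coeff 1 := by
  induction p using MvPolynomial.induction_on with
  | C a => simp
  | add p q hp hq =>
    simp only [map_add, Polynomial.coeff_add, hp, hq]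
    ring
  | mul_X p i hp =>
    have h₁ := coeff_zero_aeval (g := ![(Polynomial.X : Polynomial R), Polynomial.X])
      (by simp [Fin.forall_fin_two]) p
    have h₂ := coeff_zero_aeval (g := ![(Polynomial.X : Polynomial R), 0])
      (by simp [Fin.forall_fin_two]) p
    have h₃ := coeff_zero_aeval (g := ![0, (Polynomial.X : Polynomial R)])
      (by simp [Fin.forall_fin_two]) p
    fin_cases i <;> simp [Polynomial.coeff_mul_X, h₁, h₂, h₃]

lemma eval_motzkin_nonneg (v : Fin 2 → ℝ) : 0 ≤ eval v motzkin := by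
  have hw : |v 0 * v 1| ^ 2 = v 0 ^ 2 * v 1 ^ 2 := by rw [sq_abs, mul_pow]
  have h2 : 2 * |v 0 * v 1| ≤ v 0 ^ 2 + v 1 ^ 2 := by
    rw [abs_mul, ← sq_abs (v 0), ← sq_abs (v 1)]
    linarith [two_mul_le_add_sq |v 0| |v 1|]
  calc
    0 ≤ (|v 0 * v 1| - 1) ^ 2 * (2 * |v 0 * v 1| + 1) := by positivity
    _ = |v 0 * v 1| ^ 2 * (2 * |v 0 * v 1|) - 3 * |v 0 * v 1| ^ 2 + 1 := by ring
    _ ≤ |v 0 * v 1| ^ 2 * (v 0 ^ 2 + v 1 ^ 2) - 3 * |v 0 * v 1| ^ 2 + 1 := by gcongr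
    _ = eval v motzkin := by
      rw [hw]
      simp [motzkin]
      ring

/-- In a sum of squares representing the Motzkin polynomial, the restriction of each summand to
the diagonal has degree at most `3` and no linear term, so the coefficient of `t ^ 4` would be
a sum of squares. -/
lemma not_isSOS_motzkin : ¬ IsSOS motzkin := by
  rintro ⟨m, f, hf⟩
  have hsum (g : Fin 2 → Polynomial ℝ) : ∑ i, aeval g (f i) ^ 2 = aeval g motzkin := by
    simp [hf]
  have hx : aeval ![(Polynomial.X : Polynomial ℝ), 0] motzkin = 1 := by simp [motzkin]
  have hy : aeval ![0, (Polynomial.X : Polynomial ℝ)] motzkin = 1 := by simp [motzkin]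
  have hd : aeval ![(Polynomial.X : Polynomial ℝ), Polynomial.X] motzkin =
      Polynomial.C 2 * Polynomial.X ^ 6 - Polynomial.C 3 * Polynomial.X ^ 4 + 1 := by
    simp [motzkin, map_ofNat Polynomial.C]
    ring
  set F : Fin m → Polynomial ℝ := fun i ↦ aeval ![Polynomial.X, Polynomial.X] (f i) with hF
  have h1 (i : Fin m) : (F i).coeff 1 = 0 := by
    have hdx := Polynomial.two_mul_natDegree_le_of_sum_sq_eq ((hsum _).trans hx) i
    have hdy := Polynomial.two_mul_natDegree_le_of_sum_sq_eq ((hsum _).trans hy) i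
    rw [Polynomial.natDegree_one] at hdx hdy
    rw [hF, coeff_one_aeval_diagonal, Polynomial.coeff_eq_zero_of_natDegree_lt (by omega),
      Polynomial.coeff_eq_zero_of_natDegree_lt (by omega), add_zero]
  have h4 (i : Fin m) : (F i).coeff 4 = 0 := by
    have hdi : 2 * (F i).natDegree ≤ _ :=
      Polynomial.two_mul_natDegree_le_of_sum_sq_eq ((hsum _).trans hd) i
    have h6 : (Polynomial.C (2 : ℝ) * Polynomial.X ^ 6 - Polynomial.C 3 * Polynomial.X ^ 4
      + 1).natDegree ≤ 6 := by compute_degree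
    exact Polynomial.coeff_eq_zero_of_natDegree_lt (by omega)
  have hsq (i : Fin m) : (F i ^ 2).coeff 4 = (F i).coeff 2 ^ 2 := by
    rw [sq, Polynomial.coeff_mul]
    simp [Finset.Nat.antidiagonal_succ, h1, h4, sq]
  have hFsum : ∑ i, F i ^ 2 = _ := (hsum _).trans hd
  have hcoeff := congrArg (fun p ↦ p.coeff 4) hFsum
  have hneg : ∑ i, (F i).coeff 2 ^ 2 = -3 := by
    simpa [Polynomial.finsetSum_coeff, hsq, Polynomial.coeff_X_pow,
      Polynomial.coeff_one] using hcoeff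
  have hnonneg : 0 ≤ ∑ i, (F i).coeff 2 ^ 2 := Finset.sum_nonneg fun i _ ↦ sq_nonneg _
  linarith

/-- The Motzkin polynomial is nonnegative on all of ℝ² but is not a sum of squares;
in particular, there exists a polynomial that is nonnegative everywhere yet is not SOS. -/
theorem motzkin_nonneg_not_sos :
    ((∀ v : Fin 2 → ℝ, 0 ≤ eval v motzkin) ∧ ¬ IsSOS motzkin) ∧
      ∃ q : MvPolynomial (Fin 2) ℝ, (∀ v : Fin 2 → ℝ, 0 ≤ eval v q) ∧ ¬ IsSOS q := by
  exact ⟨⟨eval_motzkin_nonneg, not_isSOS_motzkin⟩, motzkin, eval_motzkin_nonneg, not_isSOS_motzkin⟩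
end

section
/- (Stengle's Positivstellensatz) Let f₁,…,f_{n₁}, g₁,…,g_{n₂}, h₁,…,h_{n₃} ∈ ℝ[x₁,…,xₙ]. Let P be the cone generated by the fᵢ, M the multiplicative monoid generated by the gⱼ, and I the ideal generated by the h_k. Then the following are equivalent: (1) the set {x ∈ ℝⁿ : fᵢ(x) ≥ 0 for i = 1,…,n₁, gⱼ(x) ≠ 0 for j = 1,…,n₂, h_k(x) = 0 for k = 1,…,n₃} is empty; (2) there exist f ∈ P, g ∈ M, and h ∈ I such that f + g² + h = 0. -/
/-- Membership in the cone generated by `f₁, …, f_{n₁}`. -/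
def InCone {n n₁ : ℕ} (f : Fin n₁ → MvPolynomial (Fin n) ℝ)
    (p : MvPolynomial (Fin n) ℝ) : Prop :=
  ∃ (s₀ : MvPolynomial (Fin n) ℝ) (T : Finset (Fin n₁ → ℕ))
    (s : (Fin n₁ → ℕ) → MvPolynomial (Fin n) ℝ),
    IsSOS s₀ ∧ (∀ k ∈ T, IsSOS (s k)) ∧
      p = s₀ + ∑ k ∈ T, s k * ∏ i, f i ^ k i

/-- Membership in the multiplicative monoid generated by `g₁, …, g_{n₂}`:
the finite products `Πⱼ gⱼ^{kⱼ}`. -/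
def InMonoid {n n₂ : ℕ} (g : Fin n₂ → MvPolynomial (Fin n) ℝ)
    (p : MvPolynomial (Fin n) ℝ) : Prop :=
  ∃ k : Fin n₂ → ℕ, p = ∏ j, g j ^ k j

/-- Membership in the ideal generated by `h₁, …, h_{n₃}`: the polynomials `Σₖ qₖ hₖ`. -/
def InIdeal {n n₃ : ℕ} (h : Fin n₃ → MvPolynomial (Fin n) ℝ)
    (p : MvPolynomial (Fin n) ℝ) : Prop :=
  ∃ q : Fin n₃ → MvPolynomial (Fin n) ℝ, p = ∑ k, q k * h k

section PrimeCone

variable {A : Type*} [CommRing A]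

/-- The cone generated by a cone `T` and an element `a`. -/
def Subsemiring.adjoinElement (T : Subsemiring A) (hsq : ∀ a, a * a ∈ T) (a : A) :
    Subsemiring A where
  carrier := {x | ∃ t ∈ T, ∃ s ∈ T, x = t + a * s}
  zero_mem' := ⟨0, T.zero_mem, 0, T.zero_mem, by ring⟩
  one_mem' := ⟨1, T.one_mem, 0, T.zero_mem, by ring⟩
  add_mem' := by
    rintro _ _ ⟨t, ht, s, hs, rfl⟩ ⟨t', ht', s', hs', rfl⟩
    exact ⟨t + t', T.add_mem ht ht', s + s', T.add_mem hs hs', by ring⟩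
  mul_mem' := by
    rintro _ _ ⟨t, ht, s, hs, rfl⟩ ⟨t', ht', s', hs', rfl⟩
    exact ⟨t * t' + a * a * (s * s'),
      T.add_mem (T.mul_mem ht ht') (T.mul_mem (hsq a) (T.mul_mem hs hs')),
      t * s' + s * t', T.add_mem (T.mul_mem ht hs') (T.mul_mem hs ht'), by ring⟩

/-- A cone disjoint from the negated squares of a submonoid extends to a prime cone with the
same property. -/
theorem exists_prime_cone (T₀ : Subsemiring A) (hsq : ∀ a, a * a ∈ T₀) (M : Submonoid A)
    (hM : ∀ m ∈ M, -(m * m) ∉ T₀) :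
    ∃ T : Subsemiring A, T₀ ≤ T ∧ (∀ m ∈ M, -(m * m) ∉ T) ∧ (∀ a, a ∈ T ∨ -a ∈ T) ∧
      ∀ a b, a * b ∈ T → -(a * b) ∈ T → (a ∈ T ∧ -a ∈ T) ∨ (b ∈ T ∧ -b ∈ T) := by
  obtain ⟨T, hT₀, hmax⟩ := zorn_le_nonempty₀
    {T : Subsemiring A | T₀ ≤ T ∧ ∀ m ∈ M, -(m * m) ∉ T} (by
      intro c hc hchain y hy
      refine ⟨sSup c, ⟨(hc hy).1.trans (le_sSup hy), fun m hm hmem => ?_⟩,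
        fun z hz => le_sSup hz⟩
      obtain ⟨S, hS, hmS⟩ := (Subsemiring.mem_sSup_of_directedOn ⟨y, hy⟩
        hchain.directedOn).1 hmem
      exact (hc hS).2 m hm hmS) T₀ ⟨le_rfl, hM⟩
  have hTsq : ∀ a, a * a ∈ T := fun a => hT₀ (hsq a)
  have hTM := hmax.prop.2
  have key : ∀ a ∉ T, ∃ m ∈ M, ∃ t ∈ T, ∃ s ∈ T, t + a * s = -(m * m) := by
    intro a ha
    by_contra! hcon
    have hle : T ≤ T.adjoinElement hTsq a := fun t ht => ⟨t, ht, 0, T.zero_mem, by ring⟩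
    have := hmax.le_of_ge (y := T.adjoinElement hTsq a) ⟨hT₀.trans hle, by
      rintro m hm ⟨t, ht, s, hs, h⟩
      exact hcon m hm t ht s hs h.symm⟩ hle
    exact ha (this ⟨0, T.zero_mem, 1, T.one_mem, by ring⟩)
  have htot : ∀ a, a ∈ T ∨ -a ∈ T := by
    intro a
    by_contra! h
    obtain ⟨m, hm, t, ht, s, hs, h₁⟩ := key a h.1
    obtain ⟨m', hm', t', ht', s', hs', h₂⟩ := key (-a) h.2
    refine hTM (m * m') (M.mul_mem hm hm') ?_
    have : -(m * m' * (m * m')) = m * m * t' + t * (m' * m') + t * t' + a * a * (s * s') := by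
      linear_combination (-(m' * m') - t') * h₁ + (a * s) * h₂
    rw [this]
    exact T.add_mem (T.add_mem (T.add_mem (T.mul_mem (hTsq m) ht') (T.mul_mem ht (hTsq m')))
      (T.mul_mem ht ht')) (T.mul_mem (hTsq a) (T.mul_mem hs hs'))
  have hprime : ∀ a b, a ∉ T → b ∉ T → -(a * b) ∉ T := by
    intro a b ha hb hab
    obtain ⟨m, hm, t, ht, s, hs, h₁⟩ := key a ha
    obtain ⟨m', hm', t', ht', s', hs', h₂⟩ := key b hb
    refine hTM (m * m') (M.mul_mem hm hm') ?_
    have : -(m * m' * (m * m')) =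
        m * m * t' + t * (m' * m') + t * t' + -(a * b) * (s * s') := by
      linear_combination (-(m' * m') - t') * h₁ + (a * s) * h₂
    rw [this]
    exact T.add_mem (T.add_mem (T.add_mem (T.mul_mem (hTsq m) ht') (T.mul_mem ht (hTsq m')))
      (T.mul_mem ht ht')) (T.mul_mem hab (T.mul_mem hs hs'))
  refine ⟨T, hT₀, hTM, htot, fun a b h₁ h₂ => ?_⟩
  by_contra! h
  rcases htot a with ha | ha <;> rcases htot b with hb | hb
  · exact hprime (-a) (-b) (h.1 ha) (h.2 hb) (by simpa using h₂)
  · exact hprime (-a) b (h.1 ha) (fun hb' => h.2 hb' hb) (by simpa using h₁)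
  · exact hprime a (-b) (fun ha' => h.1 ha' ha) (h.2 hb) (by simpa using h₁)
  · exact hprime a b (fun ha' => h.1 ha' ha) (fun hb' => h.2 hb' hb) h₂

end PrimeCone

section Monotone

open Polynomial

/-- The intermediate value property for polynomials over an ordered field. -/
def PolyIVT (F : Type*) [Field F] [LinearOrder F] : Prop :=
  ∀ (p : F[X]) (a b : F), a < b → p.eval a < 0 → 0 < p.eval b →
    ∃ c, a < c ∧ c < b ∧ p.eval c = 0

variable {F : Type*} [Field F] [LinearOrder F] [IsStrictOrderedRing F]

theorem PolyIVT.exists_root_of_mul_neg (hF : PolyIVT F) (p : F[X]) {a b : F} (hab : a < b)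
    (h : p.eval a * p.eval b < 0) : ∃ c, a < c ∧ c < b ∧ p.eval c = 0 := by
  rcases mul_neg_iff.1 h with ⟨h₁, h₂⟩ | ⟨h₁, h₂⟩
  · obtain ⟨c, hac, hcb, hc⟩ := hF (-p) a b hab (by simpa using h₁) (by simpa using h₂)
    exact ⟨c, hac, hcb, by simpa using hc⟩
  · exact hF p a b hab h₁ h₂

/-- Rolle's theorem between consecutive roots. -/
theorem PolyIVT.rolle_of_consecutive (hF : PolyIVT F) (p : F[X]) (hp : p ≠ 0) {a b : F}
    (hab : a < b) (ha : p.eval a = 0) (hb : p.eval b = 0)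
    (hne : ∀ x, a < x → x < b → p.eval x ≠ 0) :
    ∃ c, a < c ∧ c < b ∧ (derivative p).eval c = 0 := by
  obtain ⟨u, hpu, hu⟩ := exists_eq_pow_rootMultiplicity_mul_and_not_dvd p hp a
  have hm : 0 < rootMultiplicity a p := (rootMultiplicity_pos hp).2 ha
  set m := rootMultiplicity a p
  have hu0 : u ≠ 0 := by rintro rfl; simp at hu
  obtain ⟨q, huq, hq⟩ := exists_eq_pow_rootMultiplicity_mul_and_not_dvd u hu0 b
  have hub : u.eval b = 0 := by
    rw [hpu] at hb
    have : (b - a) ^ m ≠ 0 := pow_ne_zero _ (sub_pos.2 hab).ne'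
    simpa [this] using hb
  have hl : 0 < rootMultiplicity b u := (rootMultiplicity_pos hu0).2 hub
  set l := rootMultiplicity b u
  have hqb : q.eval b ≠ 0 := fun h => hq (dvd_iff_isRoot.2 h)
  have hqa : q.eval a ≠ 0 := fun h => hu (by
    rw [huq]; exact Dvd.dvd.mul_left (dvd_iff_isRoot.2 h) _)
  obtain ⟨m', hm'⟩ : ∃ m', m = m' + 1 := ⟨m - 1, by omega⟩
  obtain ⟨l', hl'⟩ : ∃ l', l = l' + 1 := ⟨l - 1, by omega⟩
  have hpq : p = (X - C a) ^ (m' + 1) * ((X - C b) ^ (l' + 1) * q) := by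
    rw [← hm', ← hl', ← huq, ← hpu]
  have hsame : 0 < q.eval a * q.eval b := by
    by_contra! hcon
    obtain ⟨c, hac, hcb, hc⟩ := hF.exists_root_of_mul_neg q hab
      (lt_of_le_of_ne hcon (mul_ne_zero hqa hqb))
    exact hne c hac hcb (by rw [hpq]; simp [hc])
  set r : F[X] := C ((m' : F) + 1) * (X - C b) * q + C ((l' : F) + 1) * (X - C a) * q
    + (X - C a) * (X - C b) * derivative q with hr
  have hder : derivative p = (X - C a) ^ m' * (X - C b) ^ l' * r := by
    rw [hpq, hr]
    simp only [derivative_mul, derivative_X_sub_C_pow]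
    simp only [add_tsub_cancel_right, Nat.cast_add, Nat.cast_one, map_add, map_natCast, map_one]
    ring
  obtain ⟨c, hac, hcb, hc⟩ := hF.exists_root_of_mul_neg r hab (by
    have e : r.eval a * r.eval b
        = -(((m' : F) + 1) * ((l' : F) + 1) * (b - a) ^ 2 * (q.eval a * q.eval b)) := by
      simp [hr]; ring
    rw [e, neg_lt_zero]
    have := sub_pos.2 hab
    positivity)
  exact ⟨c, hac, hcb, by rw [hder]; simp [hc]⟩

theorem PolyIVT.rolle (hF : PolyIVT F) (p : F[X]) {a b : F} (hab : a < b)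
    (ha : p.eval a = 0) (hb : p.eval b = 0) :
    ∃ c, a < c ∧ c < b ∧ (derivative p).eval c = 0 := by
  by_cases hp : p = 0
  · obtain ⟨c, hac, hcb⟩ := exists_between hab
    exact ⟨c, hac, hcb, by simp [hp]⟩
  let S := p.roots.toFinset.filter (a < ·)
  have hmem : ∀ x, x ∈ S ↔ p.eval x = 0 ∧ a < x := by simp [S, hp]
  have hS : S.Nonempty := ⟨b, (hmem b).2 ⟨hb, hab⟩⟩
  have h₁ := (hmem _).1 (S.min'_mem hS)
  have h₂ := S.min'_le b ((hmem b).2 ⟨hb, hab⟩)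
  obtain ⟨c, hac, hcb, hc⟩ := hF.rolle_of_consecutive p hp h₁.2 ha h₁.1
    (fun x hax hxb hx => (S.min'_le x ((hmem x).2 ⟨hx, hax⟩)).not_gt hxb)
  exact ⟨c, hac, hcb.trans_le h₂, hc⟩

theorem PolyIVT.eval_lt_eval (hF : PolyIVT F) (p : F[X]) {a b : F} (hab : a < b)
    (hp : ∀ x, a < x → x < b → 0 < (derivative p).eval x) : p.eval a < p.eval b := by
  by_contra! hcon
  obtain ⟨c, hac, hcb, hc⟩ := hF.rolle
    (C (b - a) * (p - C (p.eval a)) - C (p.eval b - p.eval a) * (X - C a)) hab (by simp)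
    (by simp; ring)
  have h := hp c hac hcb
  have h₂ : (b - a) * (derivative p).eval c = p.eval b - p.eval a := by
    simp at hc
    linear_combination hc
  have := mul_pos (sub_pos.2 hab) h
  linarith

end Monotone

section RealClosure

open Polynomial

variable {Ω : Type*} [Field Ω]

/-- Sums of squares of elements of `k` weighted by elements of `W`. -/
def weightedSumSq (W : Submonoid Ω) (k : Subfield Ω) : AddSubmonoid Ω :=
  AddSubmonoid.closure {z | ∃ w ∈ W, ∃ x ∈ k, z = w * x ^ 2}

variable {W : Submonoid Ω} {k : Subfield Ω}

theorem weightedSumSq_mul_sq_mem {w x : Ω} (hw : w ∈ W) (hx : x ∈ k) :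
    w * x ^ 2 ∈ weightedSumSq W k :=
  AddSubmonoid.subset_closure ⟨w, hw, x, hx, rfl⟩

theorem weightedSumSq_sq_mem {x : Ω} (hx : x ∈ k) : x ^ 2 ∈ weightedSumSq W k := by
  simpa using weightedSumSq_mul_sq_mem W.one_mem hx

theorem weightedSumSq_one_mem : (1 : Ω) ∈ weightedSumSq W k := by
  simpa using weightedSumSq_sq_mem (W := W) k.one_mem

theorem weightedSumSq_le (hW : (W : Set Ω) ⊆ k) :
    weightedSumSq W k ≤ k.toSubring.toAddSubgroup.toAddSubmonoid := by
  rw [weightedSumSq, AddSubmonoid.closure_le]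
  rintro _ ⟨w, hw, x, hx, rfl⟩
  exact k.mul_mem (hW hw) (k.pow_mem hx 2)

theorem weightedSumSq_mul_mem {x y : Ω} (hx : x ∈ weightedSumSq W k)
    (hy : y ∈ weightedSumSq W k) : x * y ∈ weightedSumSq W k := by
  induction hx using AddSubmonoid.closure_induction with
  | zero => simp [(weightedSumSq W k).zero_mem]
  | add a b _ _ iha ihb => rw [add_mul]; exact add_mem iha ihb
  | mem a ha =>
    obtain ⟨w, hw, a, ha, rfl⟩ := ha
    induction hy using AddSubmonoid.closure_induction with
    | zero => simp [(weightedSumSq W k).zero_mem]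
    | add c d _ _ ihc ihd => rw [mul_add]; exact add_mem ihc ihd
    | mem b hb =>
      obtain ⟨w', hw', b, hb, rfl⟩ := hb
      rw [show w * a ^ 2 * (w' * b ^ 2) = w * w' * (a * b) ^ 2 by ring]
      exact weightedSumSq_mul_sq_mem (W.mul_mem hw hw') (k.mul_mem ha hb)

theorem weightedSumSq_mem_of_chain {c : Set (Subfield Ω)} (hc : c.Nonempty)
    (hd : DirectedOn (· ≤ ·) c) {z : Ω} (hz : z ∈ weightedSumSq W (sSup c)) :
    ∃ k ∈ c, z ∈ weightedSumSq W k := by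
  have mono : ∀ {k k' : Subfield Ω}, k ≤ k' → weightedSumSq W k ≤ weightedSumSq W k' := by
    intro k k' h
    refine AddSubmonoid.closure_mono ?_
    rintro _ ⟨w, hw, x, hx, rfl⟩
    exact ⟨w, hw, x, h hx, rfl⟩
  induction hz using AddSubmonoid.closure_induction with
  | zero => exact ⟨_, hc.some_mem, AddSubmonoid.zero_mem _⟩
  | mem a ha =>
    obtain ⟨w, hw, x, hx, rfl⟩ := ha
    obtain ⟨k, hk, hxk⟩ := (Subfield.mem_sSup_of_directedOn hc hd).1 hx
    exact ⟨k, hk, weightedSumSq_mul_sq_mem hw hxk⟩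
  | add a b _ _ iha ihb =>
    obtain ⟨k₁, hk₁, h₁⟩ := iha
    obtain ⟨k₂, hk₂, h₂⟩ := ihb
    obtain ⟨k, hk, hl₁, hl₂⟩ := hd k₁ hk₁ k₂ hk₂
    exact ⟨k, hk, add_mem (mono hl₁ h₁) (mono hl₂ h₂)⟩

theorem exists_maximal_subfield (k₀ : Subfield Ω) (h₀ : -1 ∉ weightedSumSq W k₀) :
    ∃ R : Subfield Ω, k₀ ≤ R ∧ -1 ∉ weightedSumSq W R ∧
      ∀ k : Subfield Ω, R ≤ k → -1 ∉ weightedSumSq W k → k ≤ R := by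
  obtain ⟨R, hR₀, hmax⟩ := zorn_le_nonempty₀ {k : Subfield Ω | -1 ∉ weightedSumSq W k} (by
      intro c hc hchain y hy
      refine ⟨sSup c, fun hmem => ?_, fun z hz => le_sSup hz⟩
      obtain ⟨S, hS, hmS⟩ := weightedSumSq_mem_of_chain ⟨y, hy⟩ hchain.directedOn hmem
      exact hc hS hmS) k₀ h₀
  exact ⟨R, hR₀, hmax.prop, fun k hk hk' => hmax.le_of_ge hk' hk⟩

/-- `k` admits no proper algebraic extension in which `-1` is not a weighted sum of squares. -/
structure IsMaximalReal (W : Submonoid Ω) (k : Subfield Ω) : Prop where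
  subset : (W : Set Ω) ⊆ k
  neg_one_notMem : -1 ∉ weightedSumSq W k
  maximal : ∀ k' : Subfield Ω, k ≤ k' → -1 ∉ weightedSumSq W k' → k' ≤ k

namespace IsMaximalReal

variable (h : IsMaximalReal W k)
include h

theorem neg_one_mem_adjoin {α : Ω} (hα : IsAlgebraic k α) (hαk : α ∉ k) :
    -1 ∈ AddSubmonoid.closure {z | ∃ w ∈ W, ∃ q : k[X], z = w * aeval α q ^ 2} := by
  by_contra hcon
  refine hαk (h.maximal (IntermediateField.adjoin k {α}).toSubfield ?_ ?_
    (IntermediateField.mem_adjoin_simple_self k α))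
  · intro x hx
    exact (IntermediateField.adjoin k {α}).algebraMap_mem ⟨x, hx⟩
  · intro hmem
    refine hcon (AddSubmonoid.closure_mono ?_ hmem)
    rintro _ ⟨w, hw, x, hx, rfl⟩
    have hx' : x ∈ (IntermediateField.adjoin k {α}).toSubalgebra := hx
    rw [IntermediateField.adjoin_simple_toSubalgebra_of_isAlgebraic hα,
      Algebra.adjoin_singleton_eq_range_aeval] at hx'
    obtain ⟨q, hq⟩ := hx'
    exact ⟨w, hw, q, by rw [← hq]; rfl⟩

theorem mem_of_neg_mem {x : Ω} (hx : x ∈ weightedSumSq W k) (hx' : -x ∈ weightedSumSq W k) :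
    x = 0 := by
  by_contra hne
  apply h.neg_one_notMem
  have hxk : x ∈ k := weightedSumSq_le h.subset hx
  have := weightedSumSq_mul_mem (weightedSumSq_mul_mem hx hx')
    (weightedSumSq_sq_mem (W := W) (k.inv_mem hxk))
  convert this using 1
  field_simp

theorem mem_or_neg_mem [IsAlgClosed Ω] {x : Ω} (hx : x ∈ k) :
    x ∈ weightedSumSq W k ∨ -x ∈ weightedSumSq W k := by
  obtain ⟨y, hy⟩ := IsAlgClosed.exists_pow_nat_eq x (n := 2) (by norm_num)
  by_cases hyk : y ∈ k
  · exact Or.inl (hy ▸ weightedSumSq_sq_mem hyk)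
  right
  have halg : IsAlgebraic k y :=
    IsAlgebraic.of_pow (n := 2) (by norm_num) (hy ▸ isAlgebraic_algebraMap (⟨x, hx⟩ : k))
  have hform : ∀ q : k[X], ∃ a ∈ k, ∃ b ∈ k, aeval y q = a + b * y := by
    intro q
    induction q using Polynomial.induction_on with
    | C a => exact ⟨a, a.2, 0, k.zero_mem, by simp; rfl⟩
    | add p q hp hq =>
      obtain ⟨a, ha, b, hb, h₁⟩ := hp
      obtain ⟨a', ha', b', hb', h₂⟩ := hq
      exact ⟨a + a', k.add_mem ha ha', b + b', k.add_mem hb hb', by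
        rw [map_add, h₁, h₂]; ring⟩
    | monomial n a hp =>
      obtain ⟨c, hc, b, hb, h₁⟩ := hp
      refine ⟨b * x, k.mul_mem hb hx, c, hc, ?_⟩
      rw [pow_succ, ← mul_assoc, map_mul, h₁, aeval_X, ← hy]; ring
  have hsum : ∀ z ∈ AddSubmonoid.closure {z | ∃ w ∈ W, ∃ q : k[X], z = w * aeval y q ^ 2},
      ∃ s ∈ weightedSumSq W k, ∃ t ∈ weightedSumSq W k, ∃ u ∈ k, z = s + x * t + u * y := by
    intro z hz
    induction hz using AddSubmonoid.closure_induction with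
    | zero => exact ⟨0, zero_mem _, 0, zero_mem _, 0, k.zero_mem, by ring⟩
    | add a b _ _ iha ihb =>
      obtain ⟨s, hs, t, ht, u, hu, rfl⟩ := iha
      obtain ⟨s', hs', t', ht', u', hu', rfl⟩ := ihb
      exact ⟨s + s', add_mem hs hs', t + t', add_mem ht ht', u + u', k.add_mem hu hu', by ring⟩
    | mem z hz =>
      obtain ⟨w, hw, q, rfl⟩ := hz
      obtain ⟨a, ha, b, hb, hq⟩ := hform q
      refine ⟨w * a ^ 2, weightedSumSq_mul_sq_mem hw ha, w * b ^ 2,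
        weightedSumSq_mul_sq_mem hw hb, w * a * b + w * a * b, ?_, ?_⟩
      · have := k.mul_mem (k.mul_mem (h.subset hw) ha) hb
        exact k.add_mem this this
      · rw [hq, ← hy]; ring
  obtain ⟨s, hs, t, ht, u, hu, hz⟩ := hsum _ (h.neg_one_mem_adjoin halg hyk)
  have hsk : s ∈ k := weightedSumSq_le h.subset hs
  have htk : t ∈ k := weightedSumSq_le h.subset ht
  have hu0 : u = 0 := by
    by_contra hne
    apply hyk
    have : y = (-1 - s - x * t) / u := by
      rw [eq_div_iff hne]; linear_combination -hz
    rw [this]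
    exact k.div_mem (k.sub_mem (k.sub_mem (k.neg_mem k.one_mem) hsk) (k.mul_mem hx htk)) hu
  have ht0 : t ≠ 0 := by
    rintro rfl
    apply h.neg_one_notMem
    rw [hz, hu0]
    simpa using hs
  have hfin := weightedSumSq_mul_mem (weightedSumSq_mul_mem
    (add_mem (weightedSumSq_one_mem (W := W) (k := k)) hs) ht)
    (weightedSumSq_sq_mem (W := W) (k.inv_mem htk))
  convert hfin using 1
  rw [hu0] at hz
  field_simp
  linear_combination hz

/-- The linear order whose nonnegative elements are the weighted sums of squares. -/
noncomputable abbrev linearOrder [IsAlgClosed Ω] : LinearOrder k where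
  le x y := (y - x : Ω) ∈ weightedSumSq W k
  le_refl x := by simp [(weightedSumSq W k).zero_mem]
  le_trans x y z h₁ h₂ := by
    have := add_mem h₂ h₁
    simpa using this
  le_antisymm x y h₁ h₂ := by
    have := h.mem_of_neg_mem h₁ (by simpa using h₂)
    exact Subtype.ext (sub_eq_zero.1 this).symm
  le_total x y := by
    have := h.mem_or_neg_mem (k.sub_mem y.2 x.2)
    simpa using this
  toDecidableLE := Classical.decRel _

theorem isStrictOrderedRing [IsAlgClosed Ω] :
    @IsStrictOrderedRing k _ (h.linearOrder).toPartialOrder := by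
  let := h.linearOrder
  have : IsOrderedAddMonoid k :=
    { add_le_add_left := fun a b hab c => by
        change ((b + c : k) - (a + c : k) : Ω) ∈ weightedSumSq W k
        have : (b - a : Ω) ∈ weightedSumSq W k := hab
        simpa using this }
  have : ZeroLEOneClass k := ⟨by
    change ((1 : k) - (0 : k) : Ω) ∈ weightedSumSq W k
    simpa using weightedSumSq_one_mem (W := W) (k := k)⟩
  refine IsStrictOrderedRing.of_mul_pos fun a b ha hb => ?_
  refine lt_of_le_of_ne ?_ (mul_ne_zero ha.ne' hb.ne').symm
  change ((a * b : k) - (0 : k) : Ω) ∈ weightedSumSq W k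
  have h₁ : (a - (0 : k) : Ω) ∈ weightedSumSq W k := ha.le
  have h₂ : (b - (0 : k) : Ω) ∈ weightedSumSq W k := hb.le
  simpa using weightedSumSq_mul_mem (by simpa using h₁) (by simpa using h₂)

theorem coe_nonneg_of_mem [IsAlgClosed Ω] {x : k} (hx : (x : Ω) ∈ weightedSumSq W k) :
    (h.linearOrder).le 0 x := by
  change (x - (0 : k) : Ω) ∈ weightedSumSq W k
  simpa using hx

/-- A polynomial of minimal degree changing sign without a root in the interval would be
irreducible, and a weighted sum of squares representation of `-1` modulo it would yield a
polynomial of smaller degree changing sign. -/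
theorem exists_root_of_mul_neg [IsAlgClosed Ω] :
    let := h.linearOrder
    ∀ (n : ℕ) (p : k[X]), p.natDegree = n → ∀ a b : k, a < b →
      p.eval a * p.eval b < 0 → ∃ c, a < c ∧ c < b ∧ p.eval c = 0 := by
  intro instLO
  have instSOR := h.isStrictOrderedRing
  intro n
  induction n using Nat.strong_induction_on with
  | _ n ih =>
  intro p hpn a b hab hsign
  have hp0 : p ≠ 0 := by rintro rfl; simp at hsign
  have hn : p.natDegree ≠ 0 := by
    intro h0
    rw [eq_C_of_natDegree_eq_zero h0] at hsign
    simp only [eval_C] at hsign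
    exact (mul_self_nonneg _).not_gt hsign
  by_cases hirr : Irreducible p
  · obtain ⟨α, hα⟩ := IsAlgClosed.exists_aeval_eq_zero Ω p
      (fun h0 => hn (natDegree_eq_zero_iff_degree_le_zero.2 h0.le))
    by_cases hαk : α ∈ k
    · have hroot : p.eval (⟨α, hαk⟩ : k) = 0 := by
        have : aeval (algebraMap k Ω ⟨α, hαk⟩) p = 0 := hα
        rw [aeval_algebraMap_apply] at this
        simpa using this
      set c : k := ⟨α, hαk⟩
      obtain ⟨u, hu⟩ := dvd_iff_isRoot.2 hroot
      have hunit : IsUnit u := (hirr.isUnit_or_isUnit hu).resolve_left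
        (not_isUnit_X_sub_C c)
      obtain ⟨d, -, rfl⟩ := isUnit_iff.1 hunit
      have hab' : (a - c) * (b - c) < 0 := by
        rw [hu] at hsign
        simp only [eval_mul, eval_sub, eval_X, eval_C] at hsign
        by_contra! hcon
        have := mul_nonneg hcon (mul_self_nonneg d)
        linarith
      refine ⟨c, ?_, ?_, hroot⟩
      · by_contra! hcon
        exact hab'.not_ge (mul_nonneg (sub_nonneg.2 hcon) (sub_nonneg.2 (hcon.trans hab.le)))
      · by_contra! hcon
        exact hab'.not_ge (mul_nonneg_of_nonpos_of_nonpos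
          (sub_nonpos.2 (hab.le.trans hcon)) (sub_nonpos.2 hcon))
    · have hsum : ∀ z ∈ AddSubmonoid.closure {z | ∃ w ∈ W, ∃ q : k[X], z = w * aeval α q ^ 2},
          ∃ Q : k[X], z = aeval α Q ∧ Q.natDegree ≤ 2 * (n - 1) ∧ ∀ x, 0 ≤ Q.eval x := by
        intro z hz
        induction hz using AddSubmonoid.closure_induction with
        | zero => exact ⟨0, by simp, by simp, by simp⟩
        | add z z' _ _ h₁ h₂ =>
          obtain ⟨Q, rfl, hQ, hQ'⟩ := h₁
          obtain ⟨P, rfl, hP, hP'⟩ := h₂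
          exact ⟨Q + P, by simp, (natDegree_add_le _ _).trans (max_le hQ hP),
            fun x => by simpa using add_nonneg (hQ' x) (hP' x)⟩
        | mem z hz =>
          obtain ⟨w, hw, q, rfl⟩ := hz
          have hw0 : 0 ≤ (⟨w, h.subset hw⟩ : k) := h.coe_nonneg_of_mem (by
            simpa using weightedSumSq_mul_sq_mem hw k.one_mem)
          refine ⟨C ⟨w, h.subset hw⟩ * (q % p) ^ 2, ?_, ?_, ?_⟩
          · have : aeval α q = aeval α (q % p) := by
              conv_lhs => rw [← EuclideanDomain.div_add_mod q p]
              simp [hα]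
            rw [this, map_mul, map_pow, aeval_C]
            rfl
          · refine (natDegree_C_mul_le _ _).trans (natDegree_pow_le.trans ?_)
            have := natDegree_mod_lt q hn
            omega
          · intro x
            rw [eval_mul, eval_C, eval_pow]
            positivity
      have halg : IsAlgebraic k α := ⟨p, hp0, hα⟩
      obtain ⟨Q, hQ, hQn, hQ0⟩ := hsum _ (h.neg_one_mem_adjoin halg hαk)
      have hdvd : p ∣ 1 + Q := by
        refine (Dvd.intro _ (minpoly.eq_of_irreducible hirr hα)).trans (minpoly.dvd k α ?_)
        rw [map_add, map_one, ← hQ]; ring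
      obtain ⟨g, hg⟩ := hdvd
      have hpos : ∀ x, 0 < p.eval x * g.eval x := fun x => by
        rw [← eval_mul, ← hg, eval_add, eval_one]
        linarith [hQ0 x]
      have hg0 : g ≠ 0 := by rintro rfl; simpa using hpos a
      have hgn : g.natDegree < n := by
        have h₁ : (p * g).natDegree ≤ 2 * (n - 1) := by
          rw [← hg]
          exact (natDegree_add_le _ _).trans (max_le (by simp) hQn)
        rw [natDegree_mul hp0 hg0] at h₁
        omega
      have hgs : g.eval a * g.eval b < 0 := by
        by_contra! hcon
        have h₁ := mul_pos (hpos a) (hpos b)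
        have h₂ := mul_nonpos_of_nonpos_of_nonneg hsign.le hcon
        linarith
      obtain ⟨c, -, -, hc⟩ := ih _ hgn g rfl a b hab hgs
      simpa [hc] using hpos c
  · obtain ⟨u, v, hu, hv, huv⟩ : ∃ u v : k[X], ¬ IsUnit u ∧ ¬ IsUnit v ∧ p = u * v := by
      by_contra! hcon
      refine hirr ⟨fun hunit => hn (natDegree_eq_zero_of_isUnit hunit), fun u v huv => ?_⟩
      by_contra! hne
      exact hcon u v hne.1 hne.2 huv
    have hu0 : u ≠ 0 := by rintro rfl; simp [huv] at hp0
    have hv0 : v ≠ 0 := by rintro rfl; simp [huv] at hp0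
    have hdeg : u.natDegree + v.natDegree = n := by rw [← hpn, huv, natDegree_mul hu0 hv0]
    have hpos : ∀ w : k[X], ¬ IsUnit w → w ≠ 0 → 0 < w.natDegree := fun w hw hw0 =>
      Nat.pos_of_ne_zero fun h0 => hw (isUnit_iff_degree_eq_zero.2 (by
        rw [degree_eq_natDegree hw0, h0]; rfl))
    have hu1 := hpos u hu hu0
    have hv1 := hpos v hv hv0
    by_cases hus : u.eval a * u.eval b < 0
    · obtain ⟨c, hac, hcb, hc⟩ := ih _ (by omega) u rfl a b hab hus
      exact ⟨c, hac, hcb, by simp [huv, hc]⟩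
    · have hvs : v.eval a * v.eval b < 0 := by
        by_contra! hcon
        have := mul_nonneg (not_lt.1 hus) hcon
        rw [huv] at hsign
        simp only [eval_mul] at hsign
        linarith
      obtain ⟨c, hac, hcb, hc⟩ := ih _ (by omega) v rfl a b hab hvs
      exact ⟨c, hac, hcb, by simp [huv, hc]⟩

theorem polyIVT [IsAlgClosed Ω] : @PolyIVT k _ h.linearOrder := by
  let := h.linearOrder
  have := h.isStrictOrderedRing
  exact fun p a b hab ha hb => h.exists_root_of_mul_neg _ p rfl a b hab
    (mul_neg_of_neg_of_pos ha hb)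

end IsMaximalReal

end RealClosure

section Transfer

open Polynomial

variable {R M : Type*} [Field R] [LinearOrder R] [IsStrictOrderedRing R]
  [Field M] [LinearOrder M] [IsStrictOrderedRing M] {k : Subfield R}

/-- `g` is positive on an interval around `t` with endpoints in `k`, both over `R` and over `M`. -/
def PosNear (φ : k →+* M) (t : R) (g : k[X]) : Prop :=
  ∃ a b : k, (a : R) < t ∧ t < b ∧ (∀ x : R, a < x → x < b → 0 < g.eval₂ k.subtype x) ∧
    ∀ x : M, φ a < x → x < φ b → 0 < g.eval₂ φ x

theorem eval₂_lt_eval₂_of_derivative_pos {K F : Type*} [Field K] [Field F] [LinearOrder F]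
    [IsStrictOrderedRing F] (hF : PolyIVT F) (f : K →+* F) (g : K[X]) {a b : F} (hab : a < b)
    (h : ∀ x, a < x → x < b → 0 < (derivative g).eval₂ f x) :
    g.eval₂ f a < g.eval₂ f b := by
  simp only [← eval_map] at h ⊢
  exact hF.eval_lt_eval _ hab (by simpa only [derivative_map] using h)

section Interval

variable {φ : k →+* M} {t : R} {g : k[X]}

omit [IsStrictOrderedRing R] [IsStrictOrderedRing M] in
theorem PosNear.pos (h : PosNear φ t g) : 0 < g.eval₂ k.subtype t := by
  obtain ⟨a, b, ha, hb, h, -⟩ := h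
  exact h t ha hb

theorem PosNear.of_derivative (hR : PolyIVT R) (hM : PolyIVT M) (hφ : StrictMono φ)
    (hcl : ∀ x, g.eval₂ k.subtype x = 0 → x ∈ k) (ht : t ∉ k)
    (hg : PosNear φ t (derivative g)) : PosNear φ t g ∨ PosNear φ t (-g) := by
  obtain ⟨a, b, hat, htb, hd, hd'⟩ := hg
  have hmono : ∀ {x y : R}, a ≤ x → x < y → y ≤ b →
      g.eval₂ k.subtype x < g.eval₂ k.subtype y := fun hx hxy hy =>
    eval₂_lt_eval₂_of_derivative_pos hR _ _ hxy fun z hz hz' =>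
      hd z (hx.trans_lt hz) (hz'.trans_le hy)
  have hmono' : ∀ {x y : M}, φ a ≤ x → x < y → y ≤ φ b → g.eval₂ φ x < g.eval₂ φ y :=
    fun hx hxy hy => eval₂_lt_eval₂_of_derivative_pos hM _ _ hxy fun z hz hz' =>
      hd' z (hx.trans_lt hz) (hz'.trans_le hy)
  have hev : ∀ c : k, g.eval₂ k.subtype c = (g.eval c : k) := fun c => by
    rw [← Subfield.coe_subtype, eval₂_at_apply]
  have hev' : ∀ c : k, g.eval₂ φ (φ c) = φ (g.eval c) := fun c => eval₂_at_apply φ c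
  rcases lt_trichotomy (g.eval₂ k.subtype t) 0 with hneg | hzero | hpos
  · right
    obtain ⟨c, htc, hcb, hc⟩ : ∃ c : k, t < c ∧ (c : R) ≤ b ∧ g.eval c ≤ 0 := by
      by_cases hb : g.eval b ≤ 0
      · exact ⟨b, htb, le_rfl, hb⟩
      · obtain ⟨c, htc, hcb, hc⟩ := hR (g.map k.subtype) t b htb (by rwa [eval_map])
          (by rw [eval_map, hev]; exact_mod_cast not_le.1 hb)
        rw [eval_map] at hc
        refine ⟨⟨c, hcl c hc⟩, htc, hcb.le, le_of_eq ?_⟩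
        have := hev ⟨c, hcl c hc⟩
        exact Subtype.ext (this.symm.trans hc)
    refine ⟨a, c, hat, htc, fun x hx hx' => ?_, fun x hx hx' => ?_⟩
    · rw [eval₂_neg, neg_pos]
      refine (hmono hx.le hx' hcb).trans_le ?_
      rw [hev]; exact_mod_cast hc
    · rw [eval₂_neg, neg_pos]
      refine (hmono' hx.le hx' (hφ.monotone (by exact_mod_cast hcb))).trans_le ?_
      rw [hev', ← map_zero φ]; exact hφ.monotone hc
  · exact absurd (hcl t hzero) ht
  · left
    obtain ⟨c, hct, hac, hc⟩ : ∃ c : k, c < t ∧ a ≤ (c : R) ∧ 0 ≤ g.eval c := by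
      by_cases ha : 0 ≤ g.eval a
      · exact ⟨a, hat, le_rfl, ha⟩
      · obtain ⟨c, hac, hct, hc⟩ := hR (g.map k.subtype) a t hat
          (by rw [eval_map, hev]; exact_mod_cast not_le.1 ha) (by rwa [eval_map])
        rw [eval_map] at hc
        refine ⟨⟨c, hcl c hc⟩, hct, hac.le, ge_of_eq ?_⟩
        have := hev ⟨c, hcl c hc⟩
        exact Subtype.ext (this.symm.trans hc)
    refine ⟨c, b, hct, htb, fun x hx hx' => ?_, fun x hx hx' => ?_⟩
    · refine lt_of_le_of_lt ?_ (hmono hac hx hx'.le)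
      rw [hev]; exact_mod_cast hc
    · refine lt_of_le_of_lt ?_ (hmono' (hφ.monotone (by exact_mod_cast hac)) hx hx'.le)
      rw [hev', ← map_zero φ]; exact hφ.monotone hc

theorem posNear_or_posNear_neg (hR : PolyIVT R) (hM : PolyIVT M) (hφ : StrictMono φ) (ht : t ∉ k)
    {a b : k} (hat : a < t) (htb : t < b) (n : ℕ)
    (hcl : ∀ g : k[X], g ≠ 0 → g.natDegree < n → ∀ x, g.eval₂ k.subtype x = 0 → x ∈ k) :
    ∀ m < n, ∀ g : k[X], g ≠ 0 → g.natDegree = m → PosNear φ t g ∨ PosNear φ t (-g) := by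
  intro m
  induction m using Nat.strong_induction_on with
  | _ m ih =>
  intro hmn g hg hgm
  have hclg := hcl g hg (hgm ▸ hmn)
  by_cases hm : m = 0
  · rw [hm] at hgm
    obtain ⟨c, rfl⟩ : ∃ c, g = C c := ⟨_, eq_C_of_natDegree_eq_zero hgm⟩
    have hc : c ≠ 0 := by rintro rfl; simp at hg
    rcases lt_or_gt_of_ne hc with h | h
    · right
      have h' : φ c < 0 := by rw [← map_zero φ]; exact hφ h
      exact ⟨a, b, hat, htb, fun _ _ _ => by
        have h₂ : (c : R) < 0 := by exact_mod_cast h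
        simpa using h₂, fun _ _ _ => by simpa using h'⟩
    · left
      have h' : 0 < φ c := by rw [← map_zero φ]; exact hφ h
      exact ⟨a, b, hat, htb, fun _ _ _ => by
        have h₂ : 0 < (c : R) := by exact_mod_cast h
        simpa using h₂, fun _ _ _ => by simpa using h'⟩
  · have hd : derivative g ≠ 0 := fun h0 => hm (hgm ▸ derivative_eq_zero.1 h0)
    have hlt : (derivative g).natDegree < m := hgm ▸ natDegree_derivative_lt (hgm ▸ hm)
    rcases ih _ hlt (hlt.trans hmn) _ hd rfl with h | h
    · exact h.of_derivative hR hM hφ hclg ht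
    · have := PosNear.of_derivative (g := -g) hR hM hφ
        (fun x hx => hclg x (by simpa using hx)) ht (by simpa using h)
      simpa [or_comm] using this

end Interval

end Transfer

section Realizable

open Filter

/-- The map `θ` respects addition, multiplication, positivity and the named real constants, as far
as these can be tested inside `S`. -/
structure IsOrdHomOn {R M : Type*} [Field R] [LinearOrder R] [Field M] [LinearOrder M]
    (cR : ℝ → R) (cM : ℝ → M) (θ : R → M) (S : Set R) : Prop where
  map_add : ∀ x ∈ S, ∀ y ∈ S, x + y ∈ S → θ (x + y) = θ x + θ y
  map_mul : ∀ x ∈ S, ∀ y ∈ S, x * y ∈ S → θ (x * y) = θ x * θ y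
  map_const : ∀ r, cR r ∈ S → θ (cR r) = cM r
  map_pos : ∀ x ∈ S, 0 < x → 0 < θ x

/-- Every finite part of `s` maps to the real numbers. -/
def Realizable {R : Type*} [Field R] [LinearOrder R] (c : ℝ → R) (s : Set R) : Prop :=
  ∀ S : Finset R, (S : Set R) ⊆ s → ∃ ψ : R → ℝ, IsOrdHomOn c id ψ S

variable {R M L : Type*} [Field R] [LinearOrder R] [Field M] [LinearOrder M]
  [Field L] [LinearOrder L] {cR : ℝ → R} {cM : ℝ → M} {cL : ℝ → L}

theorem IsOrdHomOn.mono {θ : R → M} {s t : Set R} (h : IsOrdHomOn cR cM θ t) (hst : s ⊆ t) :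
    IsOrdHomOn cR cM θ s where
  map_add x hx y hy hxy := h.map_add x (hst hx) y (hst hy) (hst hxy)
  map_mul x hx y hy hxy := h.map_mul x (hst hx) y (hst hy) (hst hxy)
  map_const r hr := h.map_const r (hst hr)
  map_pos x hx := h.map_pos x (hst hx)

theorem IsOrdHomOn.comp {θ : R → M} {ψ : M → L} {s : Set R} (hψ : IsOrdHomOn cM cL ψ (θ '' s))
    (hθ : IsOrdHomOn cR cM θ s) : IsOrdHomOn cR cL (ψ ∘ θ) s where
  map_add x hx y hy hxy := by
    have e := hθ.map_add x hx y hy hxy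
    simp only [Function.comp, e]
    exact hψ.map_add _ ⟨x, hx, rfl⟩ _ ⟨y, hy, rfl⟩ ⟨_, hxy, e⟩
  map_mul x hx y hy hxy := by
    have e := hθ.map_mul x hx y hy hxy
    simp only [Function.comp, e]
    exact hψ.map_mul _ ⟨x, hx, rfl⟩ _ ⟨y, hy, rfl⟩ ⟨_, hxy, e⟩
  map_const r hr := by
    have e := hθ.map_const r hr
    simp only [Function.comp, e]
    exact hψ.map_const r ⟨_, hr, e⟩
  map_pos x hx h := hψ.map_pos _ ⟨x, hx, rfl⟩ (hθ.map_pos x hx h)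

theorem Realizable.of_isOrdHomOn {θ : R → M} {s : Set R} (hM : Realizable cM Set.univ)
    (hθ : IsOrdHomOn cR cM θ s) : Realizable cR s := by
  classical
  intro S hS
  obtain ⟨ψ, hψ⟩ := hM (S.image θ) (Set.subset_univ _)
  exact ⟨ψ ∘ θ, IsOrdHomOn.comp (by simpa using hψ) (hθ.mono hS)⟩

theorem realizable_real : Realizable (id : ℝ → ℝ) Set.univ := fun _ _ =>
  ⟨id, fun _ _ _ _ _ => rfl, fun _ _ _ _ _ => rfl, fun _ _ => rfl, fun _ _ h => h⟩

theorem Realizable.germ {ι : Type*} (U : Ultrafilter ι) (h : Realizable cL Set.univ) :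
    Realizable (fun r => ((cL r : L) : Germ (U : Filter ι) L)) Set.univ := by
  intro S hS
  let rep : Germ (U : Filter ι) L → ι → L := Quotient.out
  have hrep : ∀ x, ((rep x : ι → L) : Germ (U : Filter ι) L) = x := fun x => Quotient.out_eq x
  have h₁ : ∀ᶠ i in U, ∀ x ∈ S, ∀ y ∈ S, rep (x + y) i = rep x i + rep y i := by
    refine (eventually_all_finset _).2 fun x _ => (eventually_all_finset _).2 fun y _ => ?_
    refine (Germ.coe_eq (f := rep (x + y)) (g := rep x + rep y)).1 ?_
    rw [Germ.coe_add, hrep, hrep, hrep]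
  have h₂ : ∀ᶠ i in U, ∀ x ∈ S, ∀ y ∈ S, rep (x * y) i = rep x i * rep y i := by
    refine (eventually_all_finset _).2 fun x _ => (eventually_all_finset _).2 fun y _ => ?_
    refine (Germ.coe_eq (f := rep (x * y)) (g := rep x * rep y)).1 ?_
    rw [Germ.coe_mul, hrep, hrep, hrep]
  have h₃ : ∀ᶠ i in U, ∀ x ∈ S, ∀ r, ((cL r : L) : Germ (U : Filter ι) L) = x →
      rep x i = cL r := by
    refine (eventually_all_finset _).2 fun x _ => ?_
    by_cases hx : ∃ r, ((cL r : L) : Germ (U : Filter ι) L) = x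
    · obtain ⟨r, hr⟩ := hx
      have : rep x =ᶠ[U] fun _ => cL r := Germ.coe_eq.1 ((hrep x).trans hr.symm)
      filter_upwards [this] with i hi r' hr'
      rw [hi]
      exact Germ.const_inj.1 (hr.trans hr'.symm)
    · exact Eventually.of_forall fun i r hr => absurd ⟨r, hr⟩ hx
  have h₄ : ∀ᶠ i in U, ∀ x ∈ S, 0 < x → 0 < rep x i := by
    refine (eventually_all_finset _).2 fun x _ => ?_
    by_cases hx : 0 < x
    · rw [← hrep x, Germ.coe_pos] at hx
      exact hx.mono fun i hi _ => hi
    · exact Eventually.of_forall fun i h => absurd h hx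
  obtain ⟨i, h₁, h₂, h₃, h₄⟩ := (h₁.and (h₂.and (h₃.and h₄))).exists
  refine h.of_isOrdHomOn (θ := fun x => rep x i) (s := S) ⟨fun x hx y hy _ => h₁ x hx y hy,
    fun x hx y hy _ => h₂ x hx y hy, fun r hr => h₃ _ hr r rfl, h₄⟩ S le_rfl

theorem Realizable.exists_ultrafilter {s : Set R} (h : Realizable cR s) :
    ∃ U : Ultrafilter (R → ℝ), IsOrdHomOn cR (fun r => ((r : ℝ) : Germ (U : Filter (R → ℝ)) ℝ))
      (fun x => ((fun ψ : R → ℝ => ψ x : (R → ℝ) → ℝ) : Germ (U : Filter (R → ℝ)) ℝ)) s := by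
  classical
  let A : {S : Finset R // (S : Set R) ⊆ s} → Set (R → ℝ) :=
    fun S => {ψ | IsOrdHomOn cR id ψ (S.1 : Set R)}
  have hne : (⨅ S, 𝓟 (A S)).NeBot := by
    have : Nonempty {S : Finset R // (S : Set R) ⊆ s} := ⟨⟨∅, by simp⟩⟩
    refine iInf_neBot_of_directed' ?_ fun S => principal_neBot_iff.2 (h S.1 S.2)
    intro S T
    refine ⟨⟨S.1 ∪ T.1, by simpa using ⟨S.2, T.2⟩⟩, ?_, ?_⟩
    · exact principal_mono.2 fun ψ (hψ : IsOrdHomOn _ _ _ _) => hψ.mono (by simp)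
    · exact principal_mono.2 fun ψ (hψ : IsOrdHomOn _ _ _ _) => hψ.mono (by simp)
  let U := Ultrafilter.of (⨅ S, 𝓟 (A S))
  have hU : ∀ S : Finset R, (S : Set R) ⊆ s → ∀ᶠ ψ in (U : Filter (R → ℝ)),
      IsOrdHomOn cR id ψ (S : Set R) := fun S hS =>
    (Ultrafilter.of_le _).trans (iInf_le _ ⟨S, hS⟩) (mem_principal_self _)
  refine ⟨U, fun x hx y hy hxy => ?_, fun x hx y hy hxy => ?_, fun r hr => ?_,
    fun x hx hpos => ?_⟩
  · rw [← Germ.coe_add]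
    refine Germ.coe_eq.2 ?_
    filter_upwards [hU {x, y, x + y} (by simp [Set.insert_subset_iff, *])] with ψ hψ
    exact hψ.map_add x (by simp) y (by simp) (by simp)
  · rw [← Germ.coe_mul]
    refine Germ.coe_eq.2 ?_
    filter_upwards [hU {x, y, x * y} (by simp [Set.insert_subset_iff, *])] with ψ hψ
    exact hψ.map_mul x (by simp) y (by simp) (by simp)
  · refine Germ.coe_eq.2 ?_
    filter_upwards [hU {cR r} (by simpa using hr)] with ψ hψ
    exact hψ.map_const r (by simp)
  · refine Germ.coe_pos.2 ?_
    filter_upwards [hU {x} (by simpa using hx)] with ψ hψ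
    exact hψ.map_pos x (by simp) hpos

end Realizable

section RealizableExtension

open Filter

theorem exists_coe_eval_germ {ι F : Type*} [Field F] (U : Filter ι)
    (p : Polynomial (Germ U F)) : ∃ P : ι → Polynomial F, ∀ x : ι → F,
      p.eval (x : Germ U F) = ((fun i => (P i).eval (x i) : ι → F) : Germ U F) := by
  induction p using Polynomial.induction_on with
  | C a =>
    induction a using Germ.inductionOn with
    | h a => exact ⟨fun i => Polynomial.C (a i), fun x => by simp⟩
  | add p q hp hq =>
    obtain ⟨P, hP⟩ := hp
    obtain ⟨Q, hQ⟩ := hq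
    refine ⟨fun i => P i + Q i, fun x => ?_⟩
    rw [Polynomial.eval_add, hP, hQ, ← Germ.coe_add]
    simp only [Polynomial.eval_add]
    rfl
  | monomial n a h =>
    obtain ⟨P, hP⟩ := h
    refine ⟨fun i => P i * Polynomial.X, fun x => ?_⟩
    rw [pow_succ, ← mul_assoc, Polynomial.eval_mul, hP, Polynomial.eval_X, ← Germ.coe_mul]
    simp only [Polynomial.eval_mul, Polynomial.eval_X]
    rfl

theorem polyIVT_real : PolyIVT ℝ := by
  intro p a b hab ha hb
  obtain ⟨c, hc, hc₀⟩ := intermediate_value_Ioo hab.le (f := fun x => p.eval x)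
    p.continuous.continuousOn ⟨ha, hb⟩
  exact ⟨c, hc.1, hc.2, hc₀⟩

theorem PolyIVT.germ {ι F : Type*} [Field F] [LinearOrder F] (U : Ultrafilter ι)
    (hF : PolyIVT F) : PolyIVT (Germ (U : Filter ι) F) := by
  intro p a b hab ha hb
  induction a using Germ.inductionOn with
  | h a =>
  induction b using Germ.inductionOn with
  | h b =>
  obtain ⟨P, hP⟩ := exists_coe_eval_germ (U : Filter ι) p
  rw [hP] at ha hb
  have hev := ((Germ.coe_lt.1 hab).and ((Germ.coe_lt.1 ha).and (Germ.coe_lt.1 hb)))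
  have : ∀ i, ∃ c, a i < b i ∧ (P i).eval (a i) < 0 ∧ 0 < (P i).eval (b i) →
      a i < c ∧ c < b i ∧ (P i).eval c = 0 := by
    intro i
    by_cases hi : a i < b i ∧ (P i).eval (a i) < 0 ∧ 0 < (P i).eval (b i)
    · obtain ⟨c, hc⟩ := hF (P i) _ _ hi.1 hi.2.1 hi.2.2
      exact ⟨c, fun _ => hc⟩
    · exact ⟨0, fun h => absurd h hi⟩
  choose c hc using this
  refine ⟨(c : Germ (U : Filter ι) F), Germ.coe_lt.2 ?_, Germ.coe_lt.2 ?_, ?_⟩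
  · filter_upwards [hev] with i hi using (hc i hi).1
  · filter_upwards [hev] with i hi using (hc i hi).2.1
  · rw [hP]
    refine Germ.coe_eq.2 ?_
    filter_upwards [hev] with i hi using (hc i hi).2.2

variable {R M : Type*} [Field R] [LinearOrder R] [IsStrictOrderedRing R]
  [Field M] [LinearOrder M] [IsStrictOrderedRing M] {k : Subfield R}
  {cR : ℝ →+* R} {cM : ℝ →+* M}

theorem IsOrdHomOn.exists_ringHom {θ : R → M} (h : IsOrdHomOn cR cM θ k) :
    ∃ φ : k →+* M, StrictMono φ ∧ ∀ r (hr : cR r ∈ k), φ ⟨cR r, hr⟩ = cM r := by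
  have h₀ : θ 0 = 0 := by
    have := h.map_const 0 (by simp [k.zero_mem])
    simpa using this
  have h₁ : θ 1 = 1 := by
    have := h.map_const 1 (by simp [k.one_mem])
    simpa using this
  let φ : k →+* M :=
    { toFun x := θ x
      map_one' := h₁
      map_zero' := h₀
      map_add' x y := h.map_add x x.2 y y.2 (x + y).2
      map_mul' x y := h.map_mul x x.2 y y.2 (x * y).2 }
  refine ⟨φ, fun x y hxy => ?_, fun r hr => h.map_const r hr⟩
  have := h.map_pos ((y - x : k) : R) (y - x).2 (by simpa using hxy)
  have h₂ : 0 < φ (y - x) := this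
  rwa [map_sub, sub_pos] at h₂

theorem exists_isOrdHomOn_adjoin (φ : k →+* M) (t : R) (t' : M)
    (hpos : ∀ g : Polynomial k, 0 < g.eval₂ k.subtype t → 0 < g.eval₂ φ t')
    (hzero : ∀ g : Polynomial k, g.eval₂ k.subtype t = 0 → g.eval₂ φ t' = 0)
    (hconst : ∀ r, ∃ hr : cR r ∈ k, φ ⟨cR r, hr⟩ = cM r) :
    ∃ θ : R → M, IsOrdHomOn cR cM θ (IntermediateField.adjoin k {t}) := by
  classical
  have hk : ∀ g : Polynomial k, Polynomial.aeval t g = g.eval₂ k.subtype t := fun g => rfl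
  have hne : ∀ g : Polynomial k, g.eval₂ k.subtype t ≠ 0 → g.eval₂ φ t' ≠ 0 := by
    intro g hg
    rcases lt_or_gt_of_ne hg with h | h
    · have := hpos (-g) (by simpa using h)
      rw [Polynomial.eval₂_neg, neg_pos] at this
      exact this.ne
    · exact (hpos g h).ne'
  have hrep : ∀ x : R, ∃ r s : Polynomial k, x ∈ IntermediateField.adjoin k {t} →
      s.eval₂ k.subtype t ≠ 0 ∧ x * s.eval₂ k.subtype t = r.eval₂ k.subtype t := by
    intro x
    by_cases hx : x ∈ IntermediateField.adjoin k {t}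
    · obtain ⟨r, s, hrs⟩ := (IntermediateField.mem_adjoin_simple_iff k x).1 hx
      rw [hk, hk] at hrs
      by_cases hs : s.eval₂ k.subtype t = 0
      · exact ⟨0, 1, fun _ => by simp [hrs, hs]⟩
      · exact ⟨r, s, fun _ => ⟨hs, by rw [hrs]; field_simp⟩⟩
    · exact ⟨0, 0, fun h => absurd h hx⟩
  choose r s hrs using hrep
  let θ : R → M := fun x => (r x).eval₂ φ t' / (s x).eval₂ φ t'
  have hθ : ∀ x ∈ IntermediateField.adjoin k {t}, ∀ p q : Polynomial k,
      q.eval₂ k.subtype t ≠ 0 → x * q.eval₂ k.subtype t = p.eval₂ k.subtype t →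
      θ x * q.eval₂ φ t' = p.eval₂ φ t' := by
    intro x hx p q hq hpq
    obtain ⟨h₁, h₂⟩ := hrs x hx
    have h₃ := hzero (r x * q - p * s x) (by
      simp only [Polynomial.eval₂_sub, Polynomial.eval₂_mul, ← h₂, ← hpq]; ring)
    simp only [Polynomial.eval₂_sub, Polynomial.eval₂_mul] at h₃
    have h₄ := hne _ h₁
    simp only [θ]
    field_simp
    linear_combination h₃
  refine ⟨θ, fun x hx y hy hxy => ?_, fun x hx y hy hxy => ?_, fun a ha => ?_, fun x hx h => ?_⟩
  · obtain ⟨h₁, h₂⟩ := hrs x hx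
    obtain ⟨h₃, h₄⟩ := hrs y hy
    have := hθ (x + y) hxy (r x * s y + r y * s x) (s x * s y)
      (by rw [Polynomial.eval₂_mul]; exact mul_ne_zero h₁ h₃)
      (by simp only [Polynomial.eval₂_add, Polynomial.eval₂_mul, ← h₂, ← h₄]; ring)
    simp only [Polynomial.eval₂_add, Polynomial.eval₂_mul] at this
    have h₅ := hne _ h₁
    have h₆ := hne _ h₃
    change _ = (r x).eval₂ φ t' / (s x).eval₂ φ t' + (r y).eval₂ φ t' / (s y).eval₂ φ t'
    field_simp
    linear_combination this
  · obtain ⟨h₁, h₂⟩ := hrs x hx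
    obtain ⟨h₃, h₄⟩ := hrs y hy
    have := hθ (x * y) hxy (r x * r y) (s x * s y)
      (by rw [Polynomial.eval₂_mul]; exact mul_ne_zero h₁ h₃)
      (by simp only [Polynomial.eval₂_mul, ← h₂, ← h₄]; ring)
    simp only [Polynomial.eval₂_mul] at this
    have h₅ := hne _ h₁
    have h₆ := hne _ h₃
    change _ = (r x).eval₂ φ t' / (s x).eval₂ φ t' * ((r y).eval₂ φ t' / (s y).eval₂ φ t')
    field_simp
    linear_combination this
  · obtain ⟨hr, hφ⟩ := hconst a
    have := hθ (cR a) ha (Polynomial.C ⟨cR a, hr⟩) 1 (by simp) (by simp)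
    simpa [hφ] using this
  · obtain ⟨h₁, h₂⟩ := hrs x hx
    have h₃ : 0 < (r x * s x).eval₂ k.subtype t := by
      rw [Polynomial.eval₂_mul, ← h₂, mul_assoc]
      exact mul_pos h (mul_self_pos.2 h₁)
    have h₄ := hpos _ h₃
    rw [Polynomial.eval₂_mul] at h₄
    exact div_pos_iff.2 (mul_pos_iff.1 h₄)

end RealizableExtension

section RealizableUniv

open Filter

variable {R M : Type*} [Field R] [LinearOrder R] [IsStrictOrderedRing R]
  [Field M] [LinearOrder M] [IsStrictOrderedRing M] {k : Subfield R}

theorem exists_corresponding_root_of_posNear (hR : PolyIVT R) (hM : PolyIVT M) {φ : k →+* M}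
    (hφ : StrictMono φ) {t : R} {F : Polynomial k} (hF : F.eval₂ k.subtype t = 0)
    (hF' : PosNear φ t (Polynomial.derivative F)) :
    ∃ t' : M, F.eval₂ φ t' = 0 ∧ ∀ g, PosNear φ t g → 0 < g.eval₂ φ t' := by
  obtain ⟨a, b, hat, htb, hd, hd'⟩ := hF'
  have hmono : ∀ {x y : R}, a ≤ x → x < y → y ≤ b →
      F.eval₂ k.subtype x < F.eval₂ k.subtype y := fun hx hxy hy =>
    eval₂_lt_eval₂_of_derivative_pos hR _ _ hxy fun z hz hz' =>
      hd z (hx.trans_lt hz) (hz'.trans_le hy)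
  have hmono' : ∀ {x y : M}, φ a ≤ x → x < y → y ≤ φ b → F.eval₂ φ x < F.eval₂ φ y :=
    fun hx hxy hy => eval₂_lt_eval₂_of_derivative_pos hM _ _ hxy fun z hz hz' =>
      hd' z (hx.trans_lt hz) (hz'.trans_le hy)
  have hev : ∀ c : k, F.eval₂ k.subtype c = (F.eval c : k) := fun c => by
    rw [← Subfield.coe_subtype, Polynomial.eval₂_at_apply]
  have hev' : ∀ c : k, F.eval₂ φ (φ c) = φ (F.eval c) := fun c =>
    Polynomial.eval₂_at_apply φ c
  have root : ∀ c d : k, a ≤ c → d ≤ b → (c : R) < t → t < d →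
      ∃ x, φ c < x ∧ x < φ d ∧ F.eval₂ φ x = 0 := by
    intro c d hac hdb hct htd
    have h₁ := hmono (x := c) (y := t) (by exact_mod_cast hac) hct htb.le
    have h₂ := hmono (x := t) (y := d) hat.le htd (by exact_mod_cast hdb)
    rw [hF, hev] at h₁ h₂
    have h₃ : F.eval c < 0 := by exact_mod_cast h₁
    have h₄ : 0 < F.eval d := by exact_mod_cast h₂
    have h₅ := hφ h₃
    have h₆ := hφ h₄
    rw [map_zero] at h₅ h₆
    obtain ⟨x, hx, hx', h⟩ := hM (F.map φ) (φ c) (φ d)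
      (hφ (by exact_mod_cast hct.trans htd)) (by rwa [Polynomial.eval_map, hev'])
      (by rwa [Polynomial.eval_map, hev'])
    exact ⟨x, hx, hx', by rwa [Polynomial.eval_map] at h⟩
  obtain ⟨t', hat', htb', ht'⟩ := root a b le_rfl le_rfl hat htb
  refine ⟨t', ht', fun g ⟨c, d, hct, htd, _, hg⟩ => ?_⟩
  obtain ⟨x, hx, hx', hFx⟩ := root (max a c) (min b d) (le_max_left _ _) (min_le_left _ _)
    (by rcases max_choice a c with h | h <;> rwa [h])
    (by rcases min_choice b d with h | h <;> rwa [h])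
  have hax : φ a < x := (hφ.monotone (le_max_left a c)).trans_lt hx
  have hxb : x < φ b := hx'.trans_le (hφ.monotone (min_le_left b d))
  have : x = t' := by
    rcases lt_trichotomy x t' with h | h | h
    · exact absurd (hmono' hax.le h htb'.le) (by simp [hFx, ht'])
    · exact h
    · exact absurd (hmono' hat'.le h hxb.le) (by simp [hFx, ht'])
  exact this ▸ hg x ((hφ.monotone (le_max_right a c)).trans_lt hx)
    (hx'.trans_le (hφ.monotone (min_le_right b d)))

theorem exists_corresponding_root (hR : PolyIVT R) (hM : PolyIVT M) {φ : k →+* M}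
    (hφ : StrictMono φ) {t : R} (ht : t ∉ k) {a b : k} (hat : a < t) (htb : t < b)
    {F : Polynomial k} (hF₀ : F ≠ 0) (hF : F.eval₂ k.subtype t = 0)
    (hcl : ∀ g : Polynomial k, g ≠ 0 → g.natDegree < F.natDegree →
      ∀ x, g.eval₂ k.subtype x = 0 → x ∈ k) :
    ∃ t' : M, (∀ g : Polynomial k, 0 < g.eval₂ k.subtype t → 0 < g.eval₂ φ t') ∧
      ∀ g : Polynomial k, g.eval₂ k.subtype t = 0 → g.eval₂ φ t' = 0 := by
  have near : ∀ g : Polynomial k, g ≠ 0 → g.natDegree < F.natDegree →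
      PosNear φ t g ∨ PosNear φ t (-g) := fun g hg hdeg =>
    posNear_or_posNear_neg hR hM hφ ht hat htb F.natDegree hcl _ hdeg g hg rfl
  have hdeg : F.natDegree ≠ 0 := by
    intro h
    rw [Polynomial.eq_C_of_natDegree_eq_zero h, Polynomial.eval₂_C] at hF
    refine hF₀ ?_
    rw [Polynomial.eq_C_of_natDegree_eq_zero h, show F.coeff 0 = 0 from Subtype.ext hF, map_zero]
  obtain ⟨t', ht', hpos⟩ : ∃ t' : M, F.eval₂ φ t' = 0 ∧
      ∀ g, PosNear φ t g → 0 < g.eval₂ φ t' := by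
    rcases near (Polynomial.derivative F) (fun h => hdeg (Polynomial.derivative_eq_zero.1 h))
      (Polynomial.natDegree_derivative_lt hdeg) with h | h
    · exact exists_corresponding_root_of_posNear hR hM hφ hF h
    · obtain ⟨t', h₁, h₂⟩ := exists_corresponding_root_of_posNear hR hM hφ (F := -F)
        (by simpa using hF) (by simpa using h)
      exact ⟨t', by simpa using h₁, h₂⟩
  have hmod : ∀ g : Polynomial k, g.eval₂ k.subtype t = (g % F).eval₂ k.subtype t := by
    intro g
    conv_lhs => rw [← EuclideanDomain.mod_add_div g F]
    simp [Polynomial.eval₂_add, Polynomial.eval₂_mul, hF]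
  have hmod' : ∀ g : Polynomial k, g.eval₂ φ t' = (g % F).eval₂ φ t' := by
    intro g
    conv_lhs => rw [← EuclideanDomain.mod_add_div g F]
    simp [Polynomial.eval₂_add, Polynomial.eval₂_mul, ht']
  refine ⟨t', fun g hg => ?_, fun g hg => ?_⟩
  · rw [hmod] at hg
    rw [hmod']
    have h₀ : g % F ≠ 0 := by rintro h; simp [h] at hg
    rcases near _ h₀ (Polynomial.natDegree_mod_lt g hdeg) with h | h
    · exact hpos _ h
    · have := h.pos
      rw [Polynomial.eval₂_neg] at this
      linarith
  · rw [hmod] at hg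
    rw [hmod']
    by_cases h₀ : g % F = 0
    · simp [h₀]
    · exact absurd (hcl _ h₀ (Polynomial.natDegree_mod_lt g hdeg) t hg) ht

omit [LinearOrder M] [IsStrictOrderedRing M] in
theorem eval₂_const_germ {ι K : Type*} [Field K] (U : Filter ι) (φ : K →+* M)
    (f : K →+* Germ U M) (hf : ∀ a, f a = ((φ a : M) : Germ U M)) (x : ι → M)
    (g : Polynomial K) :
    g.eval₂ f (x : Germ U M) = ((fun i => g.eval₂ φ (x i) : ι → M) : Germ U M) := by
  induction g using Polynomial.induction_on with
  | C a => simp only [Polynomial.eval₂_C, hf]; rfl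
  | add p q hp hq =>
    rw [Polynomial.eval₂_add, hp, hq, ← Germ.coe_add]
    simp only [Polynomial.eval₂_add]
    rfl
  | monomial n a h =>
    rw [pow_succ, ← mul_assoc, Polynomial.eval₂_mul, h, Polynomial.eval₂_X, ← Germ.coe_mul]
    simp only [Polynomial.eval₂_mul, Polynomial.eval₂_X]
    rfl

theorem exists_corresponding_germ (hR : PolyIVT R) (hM : PolyIVT M) {φ : k →+* M}
    (hφ : StrictMono φ) {t : R} (ht : t ∉ k) {a b : k} (hat : a < t) (htb : t < b)
    (hcl : ∀ g : Polynomial k, g ≠ 0 → ∀ x, g.eval₂ k.subtype x = 0 → x ∈ k) :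
    ∃ (V : Ultrafilter k) (t' : Germ (V : Filter k) M), ∀ f : k →+* Germ (V : Filter k) M,
      (∀ a, f a = ((φ a : M) : Germ (V : Filter k) M)) →
      (∀ g : Polynomial k, 0 < g.eval₂ k.subtype t → 0 < g.eval₂ f t') ∧
      ∀ g : Polynomial k, g.eval₂ k.subtype t = 0 → g.eval₂ f t' = 0 := by
  let ι := {p : k × k // (p.1 : R) < t ∧ t < p.2}
  let A : ι → Set k := fun p => {u | p.1.1 < u ∧ u < p.1.2}
  have hne : (⨅ p, 𝓟 (A p)).NeBot := by
    have : Nonempty ι := ⟨⟨(a, b), hat, htb⟩⟩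
    refine iInf_neBot_of_directed' ?_ fun p => principal_neBot_iff.2
      (exists_between (show p.1.1 < p.1.2 by exact_mod_cast p.2.1.trans p.2.2))
    intro p q
    refine ⟨⟨(max p.1.1 q.1.1, min p.1.2 q.1.2), ?_, ?_⟩, ?_, ?_⟩
    · rcases max_choice p.1.1 q.1.1 with h | h
      · simpa only [h] using p.2.1
      · simpa only [h] using q.2.1
    · rcases min_choice p.1.2 q.1.2 with h | h
      · simpa only [h] using p.2.2
      · simpa only [h] using q.2.2
    · exact principal_mono.2 fun u hu =>
        ⟨(max_lt_iff.1 hu.1).1, (lt_min_iff.1 hu.2).1⟩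
    · exact principal_mono.2 fun u hu =>
        ⟨(max_lt_iff.1 hu.1).2, (lt_min_iff.1 hu.2).2⟩
  let V := Ultrafilter.of (⨅ p, 𝓟 (A p))
  refine ⟨V, (fun u : k => φ u : k → M), fun f hf => ⟨fun g hg => ?_, fun g hg => ?_⟩⟩
  · rw [eval₂_const_germ (V : Filter k) φ f hf, Germ.coe_pos]
    have hg₀ : g ≠ 0 := by rintro rfl; simp at hg
    rcases posNear_or_posNear_neg hR hM hφ ht hat htb (g.natDegree + 1)
      (fun g hg _ => hcl g hg) _ (Nat.lt_succ_self _) g hg₀ rfl with h | h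
    · obtain ⟨c, d, hct, htd, -, h⟩ := h
      have hV : A ⟨(c, d), hct, htd⟩ ∈ (V : Filter k) :=
        (Ultrafilter.of_le _).trans (iInf_le _ _) (mem_principal_self _)
      filter_upwards [hV] with u hu using h _ (hφ hu.1) (hφ hu.2)
    · have := h.pos
      rw [Polynomial.eval₂_neg] at this
      linarith
  · by_cases hg₀ : g = 0
    · simp [hg₀]
    · exact absurd (hcl g hg₀ t hg) ht

theorem exists_inv_abs_lt_one {t : R} (ht : t ∉ k) :
    (-1 < t ∧ t < 1) ∨ (-1 < t⁻¹ ∧ t⁻¹ < 1) := by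
  rw [← abs_lt, ← abs_lt, abs_inv]
  by_cases h : |t| < 1
  · exact Or.inl h
  · refine Or.inr (inv_lt_one_of_one_lt₀ (lt_of_le_of_ne (not_lt.1 h) fun h₁ => ht ?_))
    rcases eq_or_eq_neg_of_abs_eq h₁.symm with rfl | rfl
    · exact k.one_mem
    · exact k.neg_mem k.one_mem

/-- If `t ∉ k` and `k` is realizable, then so is some proper simple extension of `k`. -/
theorem Realizable.exists_notMem (hR : PolyIVT R) {c : ℝ →+* R} (hk : Realizable c (k : Set R))
    (hc : c.fieldRange ≤ k) {t : R} (ht : t ∉ k) :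
    ∃ s ∉ k, Realizable c (IntermediateField.adjoin k {s} : Set R) := by
  obtain ⟨U, hU⟩ := hk.exists_ultrafilter
  let M := Germ (U : Filter (R → ℝ)) ℝ
  let cM : ℝ →+* M := (Germ.coeRingHom (U : Filter (R → ℝ))).comp (Pi.constRingHom (R → ℝ) ℝ)
  have hM : PolyIVT M := polyIVT_real.germ U
  have hMr : Realizable cM Set.univ := realizable_real.germ U
  obtain ⟨φ, hφ, hφc⟩ := IsOrdHomOn.exists_ringHom (cR := c) (cM := cM) hU
  have hck : ∀ r, c r ∈ k := fun r => hc ⟨r, rfl⟩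
  by_cases hA : ∃ n, ∃ g : Polynomial k, g ≠ 0 ∧ g.natDegree = n ∧
      ∃ x ∉ k, g.eval₂ k.subtype x = 0
  · classical
    obtain ⟨F, hF₀, hFn, x, hxk, hFx⟩ := Nat.find_spec hA
    have hmin : ∀ g : Polynomial k, g ≠ 0 → g.natDegree < F.natDegree →
        ∀ x, g.eval₂ k.subtype x = 0 → x ∈ k := by
      intro g hg hlt x hx
      by_contra hxk
      exact Nat.find_min hA (hFn ▸ hlt) ⟨g, hg, rfl, x, hxk, hx⟩
    obtain ⟨s, hsk, hs, hs', G, hG₀, hGF, hG⟩ : ∃ s ∉ k, -1 < s ∧ s < 1 ∧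
        ∃ G : Polynomial k, G ≠ 0 ∧ G.natDegree ≤ F.natDegree ∧ G.eval₂ k.subtype s = 0 := by
      rcases exists_inv_abs_lt_one hxk with h | h
      · exact ⟨x, hxk, h.1, h.2, F, hF₀, le_rfl, hFx⟩
      · have hx₀ : x ≠ 0 := by rintro rfl; exact hxk k.zero_mem
        let := invertibleOfNonzero hx₀
        refine ⟨x⁻¹, fun h => hxk (by simpa using k.inv_mem h), h.1, h.2, F.reverse, by simpa,
          F.reverse_natDegree_le, ?_⟩
        rw [← invOf_eq_inv, Polynomial.eval₂_reverse_eq_zero_iff]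
        exact hFx
    obtain ⟨t', h₁, h₂⟩ := exists_corresponding_root hR hM hφ hsk (a := -1) (b := 1)
      (by simpa using hs) (by simpa using hs') hG₀ hG
      fun g hg hlt => hmin g hg (hlt.trans_le hGF)
    obtain ⟨θ, hθ⟩ := exists_isOrdHomOn_adjoin (cR := c) (cM := cM) φ s t' h₁ h₂
      fun r => ⟨hck r, hφc r _⟩
    exact ⟨s, hsk, hMr.of_isOrdHomOn hθ⟩
  · have hcl : ∀ g : Polynomial k, g ≠ 0 → ∀ x, g.eval₂ k.subtype x = 0 → x ∈ k := by
      intro g hg x hx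
      by_contra hxk
      exact hA ⟨_, g, hg, rfl, x, hxk, hx⟩
    obtain ⟨s, hsk, hs, hs'⟩ : ∃ s ∉ k, -1 < s ∧ s < 1 := by
      rcases exists_inv_abs_lt_one ht with h | h
      · exact ⟨t, ht, h⟩
      · exact ⟨t⁻¹, fun h => ht (by simpa using k.inv_mem h), h⟩
    obtain ⟨V, t', hV⟩ := exists_corresponding_germ hR hM hφ hsk (a := -1) (b := 1)
      (by simpa using hs) (by simpa using hs') hcl
    let const : M →+* Germ (V : Filter k) M :=
      (Germ.coeRingHom (V : Filter k)).comp (Pi.constRingHom k M)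
    obtain ⟨h₁, h₂⟩ := hV (const.comp φ) fun a => rfl
    obtain ⟨θ, hθ⟩ := exists_isOrdHomOn_adjoin (cR := c) (cM := const.comp cM) (const.comp φ)
      s t' h₁ h₂ fun r => ⟨hck r, congrArg const (hφc r _)⟩
    exact ⟨s, hsk, (hMr.germ V).of_isOrdHomOn hθ⟩

theorem realizable_univ (hR : PolyIVT R) (c : ℝ →+* R) : Realizable c Set.univ := by
  classical
  have h₀ : Realizable c (c.fieldRange : Set R) := by
    refine realizable_real.of_isOrdHomOn (θ := Function.invFun c) ?_
    have hinv : ∀ r, Function.invFun c (c r) = r := Function.leftInverse_invFun c.injective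
    refine ⟨?_, ?_, fun r _ => hinv r, ?_⟩
    · rintro _ ⟨x, rfl⟩ _ ⟨y, rfl⟩ -
      rw [← map_add, hinv, hinv, hinv]
    · rintro _ ⟨x, rfl⟩ _ ⟨y, rfl⟩ -
      rw [← map_mul, hinv, hinv, hinv]
    · rintro _ ⟨x, rfl⟩ hx
      rw [hinv]
      by_contra! hneg
      have : c x = -(c (Real.sqrt (-x)) * c (Real.sqrt (-x))) := by
        rw [← map_mul, Real.mul_self_sqrt (neg_nonneg.2 hneg), map_neg, neg_neg]
      rw [this, neg_pos] at hx
      exact hx.not_ge (mul_self_nonneg _)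
  obtain ⟨k, -, hmax⟩ := zorn_le_nonempty₀
    {k : Subfield R | c.fieldRange ≤ k ∧ Realizable c (k : Set R)} (by
      intro C hC hchain y hy
      refine ⟨sSup C, ⟨(hC hy).1.trans (le_sSup hy), fun S hS => ?_⟩, fun z hz => le_sSup hz⟩
      obtain ⟨k, hk, hSk⟩ : ∃ k ∈ C, (S : Set R) ⊆ k := by
        refine DirectedOn.exists_mem_subset_of_finset_subset_biUnion ⟨y, hy⟩
          (f := fun k : Subfield R => (k : Set R)) hchain.directedOn fun x hx => ?_
        obtain ⟨k, hk, hxk⟩ :=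
          (Subfield.mem_sSup_of_directedOn ⟨y, hy⟩ hchain.directedOn).1 (hS hx)
        exact Set.mem_biUnion hk hxk
      exact (hC hk).2 S hSk) c.fieldRange ⟨le_rfl, h₀⟩
  have htop : (k : Set R) = Set.univ := by
    by_contra hne
    obtain ⟨t, ht⟩ := (Set.ne_univ_iff_exists_notMem _).1 hne
    obtain ⟨s, hs, hreal⟩ := hmax.prop.2.exists_notMem hR hmax.prop.1 ht
    have hle : k ≤ (IntermediateField.adjoin k {s}).toSubfield := fun x hx =>
      (IntermediateField.adjoin k {s}).algebraMap_mem ⟨x, hx⟩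
    exact hs (hmax.le_of_ge (y := (IntermediateField.adjoin k {s}).toSubfield)
      ⟨hmax.prop.1.trans hle, hreal⟩ hle (IntermediateField.mem_adjoin_simple_self k s))
  exact htop ▸ hmax.prop.2

end RealizableUniv

section RealPoints

open Filter

/-- A finite system of sign conditions satisfied in a real closed field is satisfied in `ℝ`. -/
theorem exists_real_point {σ R : Type*} [Field R] [LinearOrder R] [IsStrictOrderedRing R]
    (hR : PolyIVT R) (i : MvPolynomial σ ℝ →+* R) (P : Finset (MvPolynomial σ ℝ)) :
    ∃ x : σ → ℝ, ∀ p ∈ P, (0 < i p → 0 < MvPolynomial.eval x p) ∧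
      (i p = 0 → MvPolynomial.eval x p = 0) := by
  obtain ⟨U, hU⟩ := (realizable_univ hR (i.comp MvPolynomial.C)).exists_ultrafilter
  have key : ∀ p, ((fun ψ : R → ℝ => ψ (i p) : (R → ℝ) → ℝ) : Germ (U : Filter (R → ℝ)) ℝ) =
      ((fun ψ : R → ℝ => MvPolynomial.eval (fun j => ψ (i (MvPolynomial.X j))) p :
        (R → ℝ) → ℝ) : Germ (U : Filter (R → ℝ)) ℝ) := by
    intro p
    induction p using MvPolynomial.induction_on with
    | C a =>
      simp only [MvPolynomial.eval_C]
      exact hU.map_const a (Set.mem_univ _)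
    | add p q hp hq =>
      simp only [map_add]
      exact (hU.map_add _ (Set.mem_univ _) _ (Set.mem_univ _) (Set.mem_univ _)).trans
        (congrArg₂ (· + ·) hp hq)
    | mul_X p j hp =>
      simp only [map_mul, MvPolynomial.eval_X]
      exact (hU.map_mul _ (Set.mem_univ _) _ (Set.mem_univ _) (Set.mem_univ _)).trans
        (congrArg₂ (· * ·) hp rfl)
  have hev : ∀ᶠ ψ in (U : Filter (R → ℝ)), ∀ p ∈ P,
      (0 < i p → 0 < MvPolynomial.eval (fun j => ψ (i (MvPolynomial.X j))) p) ∧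
      (i p = 0 → MvPolynomial.eval (fun j => ψ (i (MvPolynomial.X j))) p = 0) := by
    refine (eventually_all_finset _).2 fun p _ => ?_
    rcases lt_trichotomy (i p) 0 with h | h | h
    · exact Eventually.of_forall fun ψ => ⟨fun h' => absurd h' h.not_gt, fun h' => absurd h' h.ne⟩
    · have h₀ := hU.map_const 0 (Set.mem_univ _)
      simp only [map_zero] at h₀
      rw [← h, key p] at h₀
      filter_upwards [Germ.coe_eq.1 h₀] with ψ hψ
      exact ⟨fun h' => absurd h' h.not_gt, fun _ => hψ⟩
    · have h₀ := hU.map_pos _ (Set.mem_univ _) h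
      rw [key p, Germ.coe_pos] at h₀
      filter_upwards [h₀] with ψ hψ
      exact ⟨fun _ => hψ, fun h' => absurd h' h.ne'⟩
  obtain ⟨ψ, hψ⟩ := hev.exists
  exact ⟨_, hψ⟩

end RealPoints

section PrimeConeRealization

/-- A prime cone is the pullback of the nonnegative elements of a real closed field. -/
theorem exists_ringHom_of_prime_cone.{u} {A : Type u} [CommRing A] (T : Subsemiring A)
    (hsq : ∀ a, a * a ∈ T) (hone : -1 ∉ T) (htot : ∀ a, a ∈ T ∨ -a ∈ T)
    (hprime : ∀ a b, a * b ∈ T → -(a * b) ∈ T → (a ∈ T ∧ -a ∈ T) ∨ (b ∈ T ∧ -b ∈ T)) :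
    ∃ (R : Type u) (_ : Field R) (_ : LinearOrder R) (_ : IsStrictOrderedRing R) (i : A →+* R),
      PolyIVT R ∧ (∀ t ∈ T, 0 ≤ i t) ∧ ∀ a, i a = 0 → -a ∈ T := by
  let p : Ideal A :=
    { carrier := {a | a ∈ T ∧ -a ∈ T}
      zero_mem' := by simp [T.zero_mem]
      add_mem' := fun {a b} ha hb => ⟨T.add_mem ha.1 hb.1, by
        rw [neg_add]; exact T.add_mem ha.2 hb.2⟩
      smul_mem' := fun c a ha => by
        rcases htot c with hc | hc
        · exact ⟨T.mul_mem hc ha.1, by simpa using T.mul_mem hc ha.2⟩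
        · exact ⟨by simpa using T.mul_mem hc ha.2, by simpa using T.mul_mem hc ha.1⟩ }
  have hp : p.IsPrime :=
    { ne_top' := fun h => hone ((Ideal.eq_top_iff_one p).1 h).2
      mem_or_mem' := fun {a b} h => hprime a b h.1 h.2 }
  let K := FractionRing (A ⧸ p)
  let Ω := AlgebraicClosure K
  let q : A ⧸ p →+* Ω := (algebraMap K Ω).comp (algebraMap (A ⧸ p) K)
  let j : A →+* Ω := q.comp (Ideal.Quotient.mk p)
  have hq : Function.Injective q :=
    (algebraMap K Ω).injective.comp (IsFractionRing.injective (A ⧸ p) K)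
  have hj : ∀ a, j a = 0 ↔ a ∈ p := fun a => by
    rw [← Ideal.Quotient.eq_zero_iff_mem]
    exact map_eq_zero_iff q hq
  let W : Submonoid Ω := T.toSubmonoid.map j.toMonoidHom
  let k₀ : Subfield Ω := (algebraMap K Ω).fieldRange
  have hjk : ∀ a, j a ∈ k₀ := fun a => ⟨_, rfl⟩
  have hWk : (W : Set Ω) ⊆ k₀ := by
    rintro _ ⟨a, -, rfl⟩
    exact hjk a
  have hclear : ∀ z ∈ weightedSumSq W k₀, ∃ d ∉ p, ∃ t ∈ T, j d ^ 2 * z = j t := by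
    intro z hz
    induction hz using AddSubmonoid.closure_induction with
    | zero =>
      exact ⟨1, fun h => hone h.2, 0, T.zero_mem, by simp⟩
    | add x y _ _ hx hy =>
      obtain ⟨d, hd, t, ht, h⟩ := hx
      obtain ⟨e, he, s, hs, h'⟩ := hy
      refine ⟨d * e, fun hde => (hp.mem_or_mem hde).elim hd he, e * e * t + d * d * s,
        T.add_mem (T.mul_mem (hsq e) ht) (T.mul_mem (hsq d) hs), ?_⟩
      simp only [map_mul, map_add, ← h, ← h']
      ring
    | mem z hz =>
      obtain ⟨_, ⟨t, ht, rfl⟩, _, ⟨y, rfl⟩, rfl⟩ := hz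
      obtain ⟨a, b, hb, rfl⟩ := IsFractionRing.div_surjective (A := A ⧸ p) y
      obtain ⟨a, rfl⟩ := Ideal.Quotient.mk_surjective a
      obtain ⟨b, rfl⟩ := Ideal.Quotient.mk_surjective b
      have hb₀ : b ∉ p := fun h =>
        nonZeroDivisors.ne_zero hb (Ideal.Quotient.eq_zero_iff_mem.2 h)
      refine ⟨b, hb₀, t * (a * a), T.mul_mem ht (hsq a), ?_⟩
      have hjb : j b ≠ 0 := fun h => hb₀ ((hj b).1 h)
      rw [map_div₀]
      have hcancel : ∀ {F : Type u} [Field F] (x y z : F), x ≠ 0 →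
          x ^ 2 * (y * (z / x) ^ 2) = y * (z * z) := by
        intro F _ x y z hx
        field_simp
      refine (hcancel (j b) (j t) (j a) hjb).trans ?_
      rw [map_mul j, map_mul j]
  have hreal : -1 ∉ weightedSumSq W k₀ := by
    intro h
    obtain ⟨d, hd, t, ht, h⟩ := hclear _ h
    have hmem : t + d * d ∈ p := by
      rw [← hj, map_add, map_mul]
      linear_combination -h
    have hdd : d * d ∈ p := ⟨hsq d, by simpa using T.add_mem hmem.2 ht⟩
    exact hd ((hp.mem_or_mem hdd).elim id id)
  obtain ⟨R, hkR, hR, hmax⟩ := exists_maximal_subfield k₀ hreal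
  have hmr : IsMaximalReal W R := ⟨hWk.trans hkR, hR, hmax⟩
  let i : A →+* R := j.codRestrict R fun a => hkR (hjk a)
  refine ⟨R, inferInstance, hmr.linearOrder, hmr.isStrictOrderedRing, i, hmr.polyIVT,
    fun t ht => hmr.coe_nonneg_of_mem ?_, fun a ha => ?_⟩
  · have h := weightedSumSq_mul_sq_mem (W := W) (x := 1) ⟨t, ht, rfl⟩ R.one_mem
    rw [one_pow, mul_one] at h
    exact h
  · exact ((hj a).1 (congrArg Subtype.val ha)).2

end PrimeConeRealization

section Certificates

theorem IsSOS.zero {σ : Type*} : IsSOS (0 : MvPolynomial σ ℝ) := ⟨0, Fin.elim0, by simp⟩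

theorem IsSOS.sq {σ : Type*} (q : MvPolynomial σ ℝ) : IsSOS (q ^ 2) :=
  ⟨1, fun _ => q, by simp⟩

theorem IsSOS.add {σ : Type*} {p q : MvPolynomial σ ℝ} (hp : IsSOS p) (hq : IsSOS q) :
    IsSOS (p + q) := by
  obtain ⟨m, u, rfl⟩ := hp
  obtain ⟨l, v, rfl⟩ := hq
  exact ⟨m + l, Fin.append u v, by simp [Fin.sum_univ_add]⟩

theorem IsSOS.eval_nonneg {σ : Type*} {p : MvPolynomial σ ℝ} (hp : IsSOS p) (x : σ → ℝ) :
    0 ≤ MvPolynomial.eval x p := by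
  obtain ⟨m, u, rfl⟩ := hp
  simp only [map_sum, map_pow]
  positivity

variable {n n₁ : ℕ} {f : Fin n₁ → MvPolynomial (Fin n) ℝ} {p q : MvPolynomial (Fin n) ℝ}

theorem InCone.add (hp : InCone f p) (hq : InCone f q) : InCone f (p + q) := by
  classical
  obtain ⟨s₀, S, s, hs₀, hs, rfl⟩ := hp
  obtain ⟨t₀, T, t, ht₀, ht, rfl⟩ := hq
  refine ⟨s₀ + t₀, S ∪ T, fun k => (if k ∈ S then s k else 0) + if k ∈ T then t k else 0,
    hs₀.add ht₀, fun k _ => IsSOS.add ?_ ?_, ?_⟩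
  · split_ifs with h
    exacts [hs k h, IsSOS.zero]
  · split_ifs with h
    exacts [ht k h, IsSOS.zero]
  · simp only [add_mul, ite_mul, zero_mul, Finset.sum_add_distrib, Finset.sum_ite_mem,
      Finset.union_inter_cancel_left, Finset.union_inter_cancel_right]
    ring

theorem InCone.eval_nonneg (hp : InCone f p) {x : Fin n → ℝ}
    (hx : ∀ i, 0 ≤ MvPolynomial.eval x (f i)) : 0 ≤ MvPolynomial.eval x p := by
  obtain ⟨s₀, S, s, hs₀, hs, rfl⟩ := hp
  simp only [map_add, map_sum, map_mul, map_prod, map_pow]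
  exact add_nonneg (hs₀.eval_nonneg x) (Finset.sum_nonneg fun k hk =>
    mul_nonneg ((hs k hk).eval_nonneg x) (Finset.prod_nonneg fun i _ => pow_nonneg (hx i) _))

/-- The additive monoid generated by the products of a square and powers of the `f i`. -/
noncomputable def squareProducts (f : Fin n₁ → MvPolynomial (Fin n) ℝ) :
    AddSubmonoid (MvPolynomial (Fin n) ℝ) :=
  AddSubmonoid.closure {z | ∃ (q : MvPolynomial (Fin n) ℝ) (k : Fin n₁ → ℕ),
    z = q ^ 2 * ∏ i, f i ^ k i}

theorem mem_squareProducts (q : MvPolynomial (Fin n) ℝ) (k : Fin n₁ → ℕ) :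
    q ^ 2 * ∏ i, f i ^ k i ∈ squareProducts f :=
  AddSubmonoid.subset_closure ⟨q, k, rfl⟩

theorem sq_mem_squareProducts (q : MvPolynomial (Fin n) ℝ) : q ^ 2 ∈ squareProducts f := by
  simpa using mem_squareProducts (f := f) q 0

theorem inCone_of_mem_squareProducts (hp : p ∈ squareProducts f) : InCone f p := by
  induction hp using AddSubmonoid.closure_induction with
  | zero => exact ⟨0, ∅, 0, IsSOS.zero, by simp, by simp⟩
  | add x y _ _ hx hy => exact hx.add hy
  | mem z hz =>
    obtain ⟨q, k, rfl⟩ := hz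
    exact ⟨0, {k}, fun _ => q ^ 2, IsSOS.zero, fun _ _ => IsSOS.sq q, by simp⟩

theorem mul_mem_squareProducts (hp : p ∈ squareProducts f) (hq : q ∈ squareProducts f) :
    p * q ∈ squareProducts f := by
  induction hp using AddSubmonoid.closure_induction with
  | zero => simp [(squareProducts f).zero_mem]
  | add x y _ _ hx hy => rw [add_mul]; exact add_mem hx hy
  | mem x hx =>
    obtain ⟨u, k, rfl⟩ := hx
    induction hq using AddSubmonoid.closure_induction with
    | zero => simp [(squareProducts f).zero_mem]
    | add x y _ _ hx hy => rw [mul_add]; exact add_mem hx hy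
    | mem y hy =>
      obtain ⟨v, l, rfl⟩ := hy
      have : (u ^ 2 * ∏ i, f i ^ k i) * (v ^ 2 * ∏ i, f i ^ l i) =
          (u * v) ^ 2 * ∏ i, f i ^ (k + l) i := by
        simp only [Pi.add_apply, pow_add, Finset.prod_mul_distrib]
        ring
      rw [this]
      exact mem_squareProducts _ _

/-- The cone generated by the `f i` and an ideal. -/
noncomputable def coneAddIdeal (f : Fin n₁ → MvPolynomial (Fin n) ℝ)
    (I : Ideal (MvPolynomial (Fin n) ℝ)) :
    Subsemiring (MvPolynomial (Fin n) ℝ) where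
  carrier := {z | ∃ F ∈ squareProducts f, ∃ H ∈ I, z = F + H}
  zero_mem' := ⟨0, zero_mem _, 0, zero_mem _, by simp⟩
  one_mem' := ⟨1, by simpa using sq_mem_squareProducts (f := f) 1, 0, zero_mem _, by simp⟩
  add_mem' := by
    rintro _ _ ⟨F, hF, H, hH, rfl⟩ ⟨F', hF', H', hH', rfl⟩
    exact ⟨F + F', add_mem hF hF', H + H', add_mem hH hH', by ring⟩
  mul_mem' := by
    rintro _ _ ⟨F, hF, H, hH, rfl⟩ ⟨F', hF', H', hH', rfl⟩
    exact ⟨F * F', mul_mem_squareProducts hF hF', (F + H) * H' + F' * H,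
      add_mem (I.mul_mem_left _ hH') (I.mul_mem_left _ hH), by ring⟩

end Certificates

open MvPolynomial

/-- **Stengle's Positivstellensatz.** The semialgebraic set
`{x : fᵢ(x) ≥ 0, gⱼ(x) ≠ 0, hₖ(x) = 0}` is empty if and only if there exist `f` in the cone
generated by the `fᵢ`, `g` in the multiplicative monoid generated by the `gⱼ`, and `h` in
the ideal generated by the `hₖ` with `f + g² + h = 0`. -/
theorem stengle_positivstellensatz {n n₁ n₂ n₃ : ℕ}
    (f : Fin n₁ → MvPolynomial (Fin n) ℝ) (g : Fin n₂ → MvPolynomial (Fin n) ℝ)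
    (h : Fin n₃ → MvPolynomial (Fin n) ℝ) :
    {x : Fin n → ℝ | (∀ i, 0 ≤ eval x (f i)) ∧ (∀ j, eval x (g j) ≠ 0) ∧
        (∀ k, eval x (h k) = 0)} = ∅ ↔
      ∃ F G H : MvPolynomial (Fin n) ℝ,
        InCone f F ∧ InMonoid g G ∧ InIdeal h H ∧ F + G ^ 2 + H = 0 := by
  classical
  constructor
  · intro hempty
    by_contra hcert
    let I := Ideal.span (Set.range h)
    let M : Submonoid (MvPolynomial (Fin n) ℝ) :=
      { carrier := {m | InMonoid g m}
        one_mem' := ⟨0, by simp⟩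
        mul_mem' := by
          rintro _ _ ⟨k, rfl⟩ ⟨l, rfl⟩
          exact ⟨k + l, by simp [pow_add, Finset.prod_mul_distrib]⟩ }
    have hsq₀ : ∀ a, a * a ∈ coneAddIdeal f I := fun a =>
      ⟨a ^ 2, sq_mem_squareProducts a, 0, zero_mem _, by ring⟩
    obtain ⟨T, hT, hTM, htot, hprime⟩ := exists_prime_cone (coneAddIdeal f I) hsq₀ M (by
      rintro m hm ⟨F, hF, H, hH, hFH⟩
      obtain ⟨q, hq⟩ := Ideal.mem_span_range_iff_exists_fun.1 hH
      exact hcert ⟨F, m, H, inCone_of_mem_squareProducts hF, hm, ⟨q, hq.symm⟩, by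
        linear_combination -hFH⟩)
    have hsq : ∀ a, a * a ∈ T := fun a => hT (hsq₀ a)
    obtain ⟨R, _, _, _, i, hR, hi, hker⟩ := exists_ringHom_of_prime_cone T hsq
      (by simpa using hTM 1 M.one_mem) htot hprime
    obtain ⟨x, hx⟩ := exists_real_point hR i
      (Finset.univ.image f ∪ Finset.univ.image (fun j => g j * g j) ∪ Finset.univ.image h)
    have hmem : x ∈ {x : Fin n → ℝ | (∀ i, 0 ≤ eval x (f i)) ∧ (∀ j, eval x (g j) ≠ 0) ∧
        (∀ k, eval x (h k) = 0)} := by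
      refine ⟨fun j => ?_, fun j => ?_, fun j => ?_⟩
      · have hj := hx (f j) (by simp)
        have hf : f j ∈ T := hT ⟨f j, by
          simpa [Pi.single_apply, Finset.prod_ite_eq] using
            mem_squareProducts (f := f) 1 (Pi.single j 1), 0, zero_mem _, by simp⟩
        rcases (hi _ hf).lt_or_eq with h₀ | h₀
        · exact (hj.1 h₀).le
        · exact (hj.2 h₀.symm).ge
      · have hg : 0 < i (g j * g j) := by
          refine lt_of_le_of_ne (hi _ (hsq _)) fun h₀ => hTM (g j) ⟨Pi.single j 1, ?_⟩
            (hker _ h₀.symm)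
          simp [Pi.single_apply]
        have := (hx (g j * g j) (by simp)).1 hg
        rw [map_mul] at this
        exact fun h₀ => by simp [h₀] at this
      · have hh : h j ∈ I := Ideal.subset_span ⟨j, rfl⟩
        have h₁ := hi (h j) (hT ⟨0, zero_mem _, h j, hh, by simp⟩)
        have h₂ := hi (-h j) (hT ⟨0, zero_mem _, -h j, neg_mem hh, by simp⟩)
        rw [map_neg, neg_nonneg] at h₂
        exact (hx (h j) (by simp)).2 (le_antisymm h₂ h₁)
    rw [hempty] at hmem
    exact hmem
  · rintro ⟨F, G, H, hF, ⟨l, rfl⟩, ⟨q, rfl⟩, hsum⟩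
    refine Set.eq_empty_iff_forall_notMem.2 fun x ⟨hxf, hxg, hxh⟩ => ?_
    have h₁ := hF.eval_nonneg hxf
    have h₂ : 0 < eval x (∏ j, g j ^ l j) ^ 2 := by
      refine sq_pos_of_ne_zero ?_
      simp only [map_prod, map_pow]
      exact Finset.prod_ne_zero_iff.2 fun j _ => pow_ne_zero _ (hxg j)
    have h₃ := congrArg (eval x) hsum
    rw [map_add, map_add, map_zero, map_pow, map_sum] at h₃
    simp only [map_mul, hxh, mul_zero, Finset.sum_const_zero, add_zero] at h₃
    linarith
end
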